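/- For complex ν with Re ν > -1: ∫_{-1}^1 [P_ν(x)]³ (1-x²)^{(ν-1)/2} dx = (3 - 2cos(νπ)) ∫_{-1}^1 [P_ν(x)]² P_ν(-x) (1-x²)^{(ν-1)/2} dx. -/

import Mathlib

open Real MeasureTheory intervalIntegral Complex

/-- Complete elliptic integral of the first kind. -/
noncomputable def ellipticK (k : ℝ) : ℝ :=
  ∫ θ in (0:ℝ)..(π/2), (1 - k ^ 2 * Real.sin θ ^ 2) ^ (-(1/2 : ℝ))

/-- Complete elliptic integral of the second kind. -/
noncomputable def ellipticE (k : ℝ) : ℝ :=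
  ∫ θ in (0:ℝ)..(π/2), (1 - k ^ 2 * Real.sin θ ^ 2) ^ ((1/2 : ℝ))

/-- Legendre function of the first kind of degree ν : P_ν(1-2z) = ₂F₁(-ν, ν+1; 1; z). -/
noncomputable def legendreP (ν : ℂ) (x : ℂ) : ℂ :=
  ordinaryHypergeometric (-ν) (ν + 1) 1 ((1 - x) / 2)

section partone
open Filter Topology

lemma seq_K (a b : ℂ) (c : ℕ → ℂ)
    (hrec : ∀ k : ℕ, ((k:ℂ) + 1) * (a + b + k) * c (k+1) = (a + k) * (b + k) * c k) :
    ∃ K : ℂ, Tendsto (fun k : ℕ => (k:ℂ) * c k) atTop (𝓝 K) ∧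
      ((∀ᶠ k in atTop, c k ≠ 0) → K ≠ 0) ∧
      ∃ C : ℝ, ∀ k : ℕ, ‖((k:ℂ)+1) * c (k+1) - k * c k‖ ≤ C * (1 / ((k:ℝ)+1)^2) := by
  -- threshold
  obtain ⟨N, hN⟩ := exists_nat_gt (2 * (‖a‖ + ‖b‖ + 1))
  have hNa : ∀ k : ℕ, N ≤ k → ‖a‖ + ‖b‖ + 1 ≤ (k:ℝ) / 2 := by
    intro k hk
    have : (N:ℝ) ≤ k := by exact_mod_cast hk
    linarith
  have hkpos : ∀ k : ℕ, N ≤ k → (0:ℝ) < k := by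
    intro k hk
    have := hNa k hk
    have := norm_nonneg a
    have := norm_nonneg b
    linarith
  have hlow : ∀ (x : ℂ) (k : ℕ), N ≤ k → ‖x‖ ≤ ‖a‖ + ‖b‖ → (k:ℝ)/2 ≤ ‖x + k‖ := by
    intro x k hk hx
    have h1 := norm_sub_norm_le ((k:ℂ)) (-x)
    rw [norm_neg, Complex.norm_natCast, sub_neg_eq_add, add_comm (k:ℂ) x] at h1
    have := hNa k hk
    linarith
  have hne : ∀ (x : ℂ) (k : ℕ), N ≤ k → ‖x‖ ≤ ‖a‖ + ‖b‖ → x + k ≠ 0 := by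
    intro x k hk hx
    have := hlow x k hk hx
    have := hkpos k hk
    rw [← norm_pos_iff]; linarith
  have hab : ‖a + b‖ ≤ ‖a‖ + ‖b‖ := norm_add_le a b
  have ha : ‖a‖ ≤ ‖a‖ + ‖b‖ := by linarith [norm_nonneg b]
  have hb : ‖b‖ ≤ ‖a‖ + ‖b‖ := by linarith [norm_nonneg a]
  set ε : ℕ → ℂ := fun n => a * b / (((n + N : ℕ):ℂ) * (a + b + ((n + N : ℕ):ℂ))) with hε
  have hstep : ∀ n : ℕ, (((n + 1 + N : ℕ)):ℂ) * c (n + 1 + N)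
      = (((n + N : ℕ)):ℂ) * c (n + N) * (1 + ε n) := by
    intro n
    have h1 := hrec (n + N)
    have h2 := hne (a+b) (n+N) (by omega) hab
    have h3 : (((n + N : ℕ)):ℂ) ≠ 0 := by
      have := hkpos (n+N) (by omega)
      exact_mod_cast this.ne'
    have e : n + 1 + N = n + N + 1 := by omega
    rw [e]
    simp only [hε]
    field_simp
    push_cast at h1 ⊢
    linear_combination h1
  have hprod : ∀ n : ℕ, (((n + N : ℕ)):ℂ) * c (n + N)
      = (N:ℂ) * c N * ∏ i ∈ Finset.range n, (1 + ε i) := by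
    intro n
    induction n with
    | zero => simp
    | succ n ih => rw [hstep, ih, Finset.prod_range_succ]; ring
  have hεb : ∀ n, ‖ε n‖ ≤ 2 * ‖a*b‖ * (1 / ((n + N : ℕ):ℝ)^2) := by
    intro n
    simp only [hε]
    rw [norm_div, norm_mul (((n+N:ℕ)):ℂ), Complex.norm_natCast]
    have h1 := hlow (a+b) (n+N) (by omega) hab
    have h2 := hkpos (n+N) (by omega)
    rw [div_le_iff₀ (mul_pos h2 (by linarith))]
    have : 2 * ‖a*b‖ * (1 / ((n + N : ℕ):ℝ)^2) * ((((n+N:ℕ)):ℝ) * ((((n+N:ℕ)):ℝ)/2)) = ‖a*b‖ := by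
      field_simp
    refine this.symm.le.trans ?_
    gcongr
  have hεs : Summable (fun n => ‖ε n‖) := by
    refine Summable.of_nonneg_of_le (fun n => norm_nonneg _) hεb ?_
    apply Summable.mul_left
    exact (summable_nat_add_iff (f := fun n : ℕ => 1 / (n:ℝ)^2) N).2
      (Real.summable_one_div_nat_pow.2 (by norm_num))
  have hlim := (multipliable_one_add_of_summable hεs).tendsto_prod_tprod_nat
  have hT : Tendsto (fun k : ℕ => (k:ℂ) * c k) atTop
      (𝓝 ((N:ℂ) * c N * ∏' i, (1 + ε i))) := by
    rw [← tendsto_add_atTop_iff_nat N]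
    simp_rw [hprod]
    exact hlim.const_mul _
  refine ⟨_, hT, ?_, ?_⟩
  · intro hev
    refine mul_ne_zero ?_ ?_
    · obtain ⟨M, hM⟩ := eventually_atTop.1 hev
      have h1 := hprod M
      intro h0
      rw [h0, zero_mul] at h1
      rcases mul_eq_zero.1 h1 with h | h
      · have := hkpos (M+N) (by omega)
        exact this.ne' (by exact_mod_cast h)
      · exact hM (M+N) (by omega) h
    · apply tprod_one_add_ne_zero_of_summable _ hεs
      intro n
      have h1 : (1 + ε n) * ((((n+N:ℕ)):ℂ) * (a + b + ((n + N : ℕ):ℂ)))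
          = (a + ((n+N:ℕ):ℂ)) * (b + ((n+N:ℕ):ℂ)) := by
        have h2 := hne (a+b) (n+N) (by omega) hab
        have h3 : (((n + N : ℕ)):ℂ) ≠ 0 := by
          have := hkpos (n+N) (by omega)
          exact_mod_cast this.ne'
        simp only [hε]
        field_simp
        ring
      intro h0
      rw [h0, zero_mul] at h1
      exact mul_ne_zero (hne a (n+N) (by omega) ha) (hne b (n+N) (by omega) hb) h1.symm
  · obtain ⟨B, hB⟩ := (hT.norm.bddAbove_range)
    have hB' : ∀ k : ℕ, ‖(k:ℂ) * c k‖ ≤ B := fun k => hB ⟨k, rfl⟩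
    have hB0 : 0 ≤ B := (norm_nonneg _).trans (hB' 0)
    set C : ℝ := max (2 * B * (N+1)^2) (8 * ‖a*b‖ * B) with hC
    refine ⟨C, fun k => ?_⟩
    have hk1 : (0:ℝ) < (k:ℝ) + 1 := by positivity
    rcases lt_or_ge k N with hk | hk
    · have : ‖((k:ℂ)+1) * c (k+1) - k * c k‖ ≤ 2 * B := by
        refine (norm_sub_le _ _).trans ?_
        have h1 := hB' (k+1)
        push_cast at h1
        linarith [hB' k]
      refine this.trans ?_
      rw [mul_one_div, le_div_iff₀ (by positivity)]
      refine le_trans ?_ (le_max_left _ _)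
      have : (k:ℝ) ≤ N := by exact_mod_cast hk.le
      gcongr
    · have h2 := hne (a+b) k hk hab
      have h3 := hkpos k hk
      have h3' : (k:ℂ) ≠ 0 := by exact_mod_cast h3.ne'
      have h4 : ((k:ℂ)+1) * c (k+1) - k * c k = a * b * (k * c k) / (k * (a + b + k)) := by
        have h1 := hrec k
        field_simp
        linear_combination h1
      rw [h4, norm_div, norm_mul, norm_mul (k:ℂ) (a+b+k), Complex.norm_natCast]
      have h5 := hlow (a+b) k hk hab
      rw [mul_one_div, div_le_div_iff₀ (mul_pos h3 (by linarith)) (by positivity)]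
      have h6 : (1:ℝ) ≤ k := by
        have := hNa k hk
        linarith [norm_nonneg a, norm_nonneg b]
      calc ‖a*b‖ * ‖(k:ℂ) * c k‖ * ((k:ℝ)+1)^2 ≤ ‖a*b‖ * B * (2 * k)^2 := by
            gcongr
            · exact hB' k
            · linarith
        _ = (8 * ‖a*b‖ * B) * (k * (k/2)) := by ring
        _ ≤ C * (k * ‖a+b+k‖) := by
            gcongr
            exact le_max_right _ _

lemma seq_rate (d : ℕ → ℂ) (K : ℂ) (hd : Tendsto d atTop (𝓝 K)) (C : ℝ)
    (h : ∀ k : ℕ, ‖d (k+1) - d k‖ ≤ C * (1 / ((k:ℝ)+1)^2)) :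
    ∀ k : ℕ, 1 ≤ k → ‖d k - K‖ ≤ C / k := by
  have hC : 0 ≤ C := by
    have := (norm_nonneg _).trans (h 0)
    simpa using this
  intro k hk
  have hk0 : (0:ℝ) < k := by exact_mod_cast hk
  have key : ∀ n : ℕ, ‖d (k + n) - d k‖ ≤ C * (1 / k - 1 / (k + n)) := by
    intro n
    induction n with
    | zero => simp
    | succ n ih =>
      have h1 := h (k+n)
      have h2 : ‖d (k + (n+1)) - d k‖ ≤ ‖d (k+n+1) - d (k+n)‖ + ‖d (k+n) - d k‖ := by
        rw [show k + (n+1) = k+n+1 by ring]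
        refine le_trans (le_of_eq ?_) (norm_add_le _ _)
        congr 1; ring
      refine h2.trans ((add_le_add h1 ih).trans ?_)
      rw [← mul_add]
      gcongr
      push_cast
      have h3 : (1:ℝ) / ((k:ℝ)+n+1)^2 ≤ 1/((k:ℝ)+n) - 1/(k+(n+1)) := by
        rw [div_sub_div _ _ (by positivity) (by positivity), div_le_div_iff₀ (by positivity) (by positivity)]
        have : (0:ℝ) ≤ k + n := by positivity
        nlinarith
      linarith
  have hl : Tendsto (fun n => ‖d (k+n) - d k‖) atTop (𝓝 ‖K - d k‖) := by
    have : Tendsto (fun n => d (k+n)) atTop (𝓝 K) := by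
      have := (tendsto_add_atTop_iff_nat k).2 hd
      simpa [add_comm] using this
    exact (this.sub_const _).norm
  rw [norm_sub_rev]
  refine le_of_tendsto hl (Eventually.of_forall fun n => (key n).trans ?_)
  rw [div_eq_mul_one_div C]
  gcongr
  have : (0:ℝ) ≤ 1/(k+n) := by positivity
  linarith

end partone
section parttwo
open Filter Topology

lemma ps_deriv (c : ℕ → ℂ) (B : ℝ) (hB : ∀ k : ℕ, ‖(k:ℂ) * c k‖ ≤ B) (u : ℂ) (hu : ‖u‖ < 1) :
    Summable (fun k => c k * u ^ k) ∧ Summable (fun k : ℕ => ((k:ℂ)+1) * c (k+1) * u ^ k) ∧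
    HasDerivAt (fun w : ℂ => ∑' k, c k * w ^ k) (∑' k : ℕ, ((k:ℂ)+1) * c (k+1) * u ^ k) u := by
  have hB0 : 0 ≤ B := (norm_nonneg _).trans (hB 0)
  have hcb : ∀ k, ‖c k‖ ≤ ‖c 0‖ + B := by
    intro k
    rcases Nat.eq_zero_or_pos k with rfl | hk
    · linarith
    · have h1 := hB k
      rw [norm_mul, Complex.norm_natCast] at h1
      have h2 : (1:ℝ) ≤ k := by exact_mod_cast hk
      nlinarith [norm_nonneg (c k), norm_nonneg (c 0)]
  have s1 : ∀ w : ℂ, ‖w‖ < 1 → Summable (fun k => c k * w ^ k) := by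
    intro w hw
    refine Summable.of_norm_bounded (g := fun k => (‖c 0‖ + B) * ‖w‖^k) ?_ ?_
    · exact (summable_geometric_of_lt_one (norm_nonneg _) hw).mul_left _
    · intro k
      rw [norm_mul, norm_pow]
      gcongr
      exact hcb k
  have s2 : Summable (fun k : ℕ => ((k:ℂ)+1) * c (k+1) * u ^ k) := by
    refine Summable.of_norm_bounded (g := fun k => B * ‖u‖^k) ?_ ?_
    · exact (summable_geometric_of_lt_one (norm_nonneg _) hu).mul_left _
    · intro k
      rw [norm_mul, norm_pow]
      gcongr
      have := hB (k+1)
      push_cast at this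
      exact this
  refine ⟨s1 u hu, s2, ?_⟩
  obtain ⟨r, hur, hr1⟩ := exists_between hu
  have hr0 : 0 ≤ r := (norm_nonneg _).trans hur.le
  have hsum : Summable (fun k : ℕ => B * r ^ (k-1)) := by
    rw [← summable_nat_add_iff 1]
    simpa using (summable_geometric_of_lt_one hr0 hr1).mul_left B
  have key := hasDerivAt_tsum_of_isPreconnected (u := fun k : ℕ => B * r ^ (k-1))
    (g := fun k w => c k * w ^ k) (g' := fun k w => c k * (k * w ^ (k-1)))
    (t := Metric.ball (0:ℂ) r) (y₀ := u) (y := u) hsum Metric.isOpen_ball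
    (convex_ball _ _).isPreconnected
    (fun n y _ => (hasDerivAt_pow n y).const_mul _)
    (by
      intro n y hy
      rw [mem_ball_zero_iff] at hy
      have : c n * ((n:ℂ) * y ^ (n-1)) = (n * c n) * y^(n-1) := by ring
      rw [this, norm_mul, norm_pow]
      gcongr
      exact hB n)
    (by simpa using hur) (s1 u hu) (by simpa using hur)
  have hv : (∑' k : ℕ, ((k:ℂ)+1) * c (k+1) * u ^ k) = ∑' k : ℕ, c k * (k * u ^ (k-1)) := by
    symm
    rw [Summable.tsum_eq_zero_add]
    · simp only [Nat.cast_zero, zero_mul, mul_zero, zero_add, Nat.add_sub_cancel]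
      congr 1; ext k; push_cast; ring
    · rw [← summable_nat_add_iff 1]
      refine s2.congr fun k => ?_
      simp only [Nat.add_sub_cancel]
      push_cast; ring
  rw [hv]
  exact key

lemma one_sub_mem_slit (u : ℂ) (hu : ‖u‖ ≤ 1) (h1 : u ≠ 1) : 1 - u ∈ Complex.slitPlane := by
  rw [Complex.mem_slitPlane_iff]
  left
  have h2 := (Complex.re_le_norm u).trans hu
  rcases h2.lt_or_eq with h | h
  · simp; linarith
  · exfalso
    apply h1
    have h3 : ‖u‖ ^ 2 ≤ 1 := by nlinarith [norm_nonneg u]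
    rw [Complex.sq_norm, Complex.normSq_apply] at h3
    have : u.im = 0 := by nlinarith [mul_self_nonneg u.im]
    apply Complex.ext <;> simp [h, this]

lemma abs_log_bd (η : ℝ) (hη : 0 < η) (x : ℝ) (hx : 0 < x) (hx2 : x ≤ 2) :
    |Real.log x| ≤ (1/η + 2^η) * x^(-η) := by
  have h0 : 0 < x^(-η) := Real.rpow_pos_of_pos hx _
  rw [abs_le]
  constructor
  · have h1 := Real.log_le_rpow_div (x := x⁻¹) (by positivity) hη
    rw [Real.log_inv, Real.inv_rpow hx.le, ← Real.rpow_neg hx.le] at h1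
    have : (0:ℝ) < 2^η := by positivity
    have : 0 ≤ 2^η * x^(-η) := by positivity
    have e : x^(-η)/η = 1/η * x^(-η) := by ring
    linarith [add_mul (1/η) (2^η) (x^(-η))]
  · have h1 : Real.log x ≤ 1 := by
      have := Real.log_le_sub_one_of_pos hx
      linarith
    have h2 : 1 ≤ 2^η * x^(-η) := by
      rw [Real.rpow_neg hx.le, ← div_eq_mul_inv, le_div_iff₀ (by positivity), one_mul]
      gcongr
    have : 0 ≤ 1/η * x^(-η) := by positivity
    linarith [add_mul (1/η) (2^η) (x^(-η))]

lemma pkg (a b : ℂ) (c : ℕ → ℂ)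
    (hrec : ∀ k : ℕ, ((k:ℂ) + 1) * (a + b + k) * c (k+1) = (a + k) * (b + k) * c k) :
    ∃ (K : ℂ) (F G : ℂ → ℂ), ((∀ᶠ k in atTop, c k ≠ 0) → K ≠ 0) ∧
      (∀ u, ‖u‖ < 1 → F u = ∑' k, c k * u ^ k) ∧ G 1 = K ∧
      ContinuousOn G (Metric.closedBall 0 1) ∧
      ContinuousOn F (Metric.closedBall 0 1 \ {1}) ∧
      (∀ u, ‖u‖ < 1 → HasDerivAt F (G u / (1 - u)) u) ∧
      (∀ u, ‖u‖ < 1 → u ≠ 0 → HasDerivAt G ((a * b * F u - (a + b) * G u) / u) u) ∧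
      (∀ η : ℝ, 0 < η → ∃ C : ℝ, 0 ≤ C ∧ ∀ u, ‖u‖ ≤ 1 → u ≠ 1 → ‖F u‖ ≤ C * ‖1 - u‖ ^ (-η)) := by
  obtain ⟨K, hK, hKne, C, hC⟩ := seq_K a b c hrec
  have hC' : ∀ k : ℕ, ‖((k+1:ℕ):ℂ) * c (k+1) - k * c k‖ ≤ C * (1 / ((k:ℝ)+1)^2) := by
    intro k
    have := hC k
    push_cast
    exact this
  have hrate := seq_rate (fun k => (k:ℂ) * c k) K hK C hC'
  obtain ⟨B, hB⟩ := (hK.norm.bddAbove_range)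
  have hB' : ∀ k : ℕ, ‖(k:ℂ) * c k‖ ≤ B := fun k => hB ⟨k, rfl⟩
  have hC0 : 0 ≤ C := by simpa using (norm_nonneg _).trans (hC 0)
  set δ : ℕ → ℂ := fun k => ((k:ℂ)+1) * c (k+1) - k * c k with hδ
  set e : ℕ → ℂ := fun k => c k - K / k with he
  have hsq : Summable (fun k : ℕ => C * (1 / ((k:ℝ)+1)^2)) := by
    apply Summable.mul_left
    have := (summable_nat_add_iff (f := fun n : ℕ => 1 / (n:ℝ)^2) 1).2
      (Real.summable_one_div_nat_pow.2 (by norm_num))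
    simpa using this
  have hes : Summable (fun k => ‖e k‖) := by
    rw [← summable_nat_add_iff 1]
    refine Summable.of_nonneg_of_le (fun _ => norm_nonneg _) (fun k => ?_) hsq
    have h1 := hrate (k+1) (by omega)
    have h0 : ((k:ℂ)+1) ≠ 0 := by exact_mod_cast (Nat.succ_ne_zero k)
    have h2 : e (k+1) = (((k+1:ℕ):ℂ) * c (k+1) - K) / ((k+1:ℕ):ℂ) := by
      simp only [he]
      push_cast
      field_simp
    rw [h2, norm_div, Complex.norm_natCast]
    push_cast at h1 ⊢
    calc _ ≤ (C / ((k:ℝ)+1)) / ((k:ℝ)+1) := by gcongr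
      _ = _ := by field_simp
  have hpowle : ∀ (u : ℂ), ‖u‖ ≤ 1 → ∀ k, ‖u^k‖ ≤ 1 := by
    intro u hu k
    rw [norm_pow]; exact pow_le_one₀ (norm_nonneg _) hu
  have hGc : ContinuousOn (fun u : ℂ => ∑' k, δ k * u^k) (Metric.closedBall 0 1) := by
    refine continuousOn_tsum (u := fun k : ℕ => C * (1 / ((k:ℝ)+1)^2)) (by fun_prop) hsq ?_
    intro k u hu
    rw [norm_mul]
    exact (mul_le_of_le_one_right (norm_nonneg _) (hpowle u (by simpa using hu) k)).trans (hC k)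
  have hRc : ContinuousOn (fun u : ℂ => ∑' k, e k * u^k) (Metric.closedBall 0 1) := by
    refine continuousOn_tsum (u := fun k : ℕ => ‖e k‖) (by fun_prop) hes ?_
    intro k u hu
    rw [norm_mul]
    exact (mul_le_of_le_one_right (norm_nonneg _) (hpowle u (by simpa using hu) k))
  set F : ℂ → ℂ := fun u => K * (-Complex.log (1 - u)) + ∑' k, e k * u ^ k with hF
  set G : ℂ → ℂ := fun u => ∑' k, δ k * u ^ k with hG
  have hFs : ∀ u, ‖u‖ < 1 → F u = ∑' k, c k * u ^ k := by
    intro u hu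
    have h1 := (Complex.hasSum_taylorSeries_neg_log hu).mul_left K
    have h2 : Summable (fun k => e k * u^k) := by
      refine Summable.of_norm_bounded hes fun k => ?_
      rw [norm_mul]
      exact (mul_le_of_le_one_right (norm_nonneg _) (hpowle u hu.le k))
    have h3 := h1.add h2.hasSum
    simp only [hF]
    rw [← h3.tsum_eq]
    congr 1; ext k
    simp only [he]
    ring
  refine ⟨K, F, G, hKne, hFs, ?_, hGc, ?_, ?_, ?_, ?_⟩
  · -- G 1
    have hs : Summable δ := Summable.of_norm_bounded hsq hC
    have h1 := hs.hasSum.tendsto_sum_nat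
    have h2 : ∀ n, ∑ k ∈ Finset.range n, δ k = (n:ℂ) * c n := by
      intro n
      have := Finset.sum_range_sub (fun k : ℕ => (k:ℂ) * c k) n
      simp only [Nat.cast_add, Nat.cast_one, Nat.cast_zero, zero_mul, sub_zero] at this
      exact this
    simp_rw [h2] at h1
    simp only [hG, one_pow, mul_one]
    exact tendsto_nhds_unique h1 hK
  · refine ContinuousOn.add ?_ (hRc.mono Set.sdiff_subset)
    refine ContinuousOn.mul continuousOn_const (ContinuousOn.neg ?_)
    refine ContinuousOn.clog (by fun_prop) ?_
    rintro u ⟨hu, hu1⟩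
    exact one_sub_mem_slit u (by simpa using hu) (by simpa using hu1)
  · intro u hu
    obtain ⟨s1, s2, hd⟩ := ps_deriv c B hB' u hu
    have hu1 : 1 - u ≠ 0 := by
      intro h
      have : u = 1 := by linear_combination -h
      rw [this] at hu; simp at hu
    have hval : G u / (1 - u) = ∑' k : ℕ, ((k:ℂ)+1) * c (k+1) * u ^ k := by
      rw [div_eq_iff hu1]
      have s3 : Summable (fun k : ℕ => (k:ℂ) * c k * u^k) := by
        rw [← summable_nat_add_iff 1]
        refine (s2.mul_left u).congr fun k => ?_
        push_cast; ring
      have h3 : ∑' k : ℕ, (k:ℂ) * c k * u^k = u * ∑' k : ℕ, ((k:ℂ)+1) * c (k+1) * u ^ k := by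
        rw [s3.tsum_eq_zero_add, ← tsum_mul_left]
        simp only [Nat.cast_zero, zero_mul, zero_add]
        congr 1; ext k; push_cast; ring
      have h4 : G u = ∑' k : ℕ, ((k:ℂ)+1) * c (k+1) * u ^ k - ∑' k : ℕ, (k:ℂ) * c k * u^k := by
        rw [← s2.tsum_sub s3]
        simp only [hG, hδ]
        congr 1; ext k; ring
      rw [h4, h3]; ring
    rw [hval]
    refine hd.congr_of_eventuallyEq ?_
    have : Metric.ball (0:ℂ) 1 ∈ 𝓝 u := Metric.isOpen_ball.mem_nhds (by simpa using hu)
    filter_upwards [this] with w hw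
    exact hFs w (by simpa using hw)
  · intro u hu hu0
    have hδB : ∀ k : ℕ, ‖(k:ℂ) * δ k‖ ≤ C := by
      intro k
      rw [norm_mul, Complex.norm_natCast]
      have h1 := hC k
      calc (k:ℝ) * ‖δ k‖ ≤ ((k:ℝ)+1)^2 * (C * (1 / ((k:ℝ)+1)^2)) := by
            gcongr
            nlinarith [(Nat.cast_nonneg k : (0:ℝ) ≤ k)]
        _ = C := by field_simp
    obtain ⟨s1, s2, hd⟩ := ps_deriv δ C hδB u hu
    obtain ⟨t1, -, -⟩ := ps_deriv c B hB' u hu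
    have hval : (a * b * F u - (a + b) * G u) / u = ∑' k : ℕ, ((k:ℂ)+1) * δ (k+1) * u ^ k := by
      rw [div_eq_iff hu0]
      have s3 : Summable (fun k : ℕ => (k:ℂ) * δ k * u^k) := by
        rw [← summable_nat_add_iff 1]
        refine (s2.mul_left u).congr fun k => ?_
        push_cast; ring
      have h3 : ∑' k : ℕ, (k:ℂ) * δ k * u^k = u * ∑' k : ℕ, ((k:ℂ)+1) * δ (k+1) * u ^ k := by
        rw [s3.tsum_eq_zero_add, ← tsum_mul_left]
        simp only [Nat.cast_zero, zero_mul, zero_add]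
        congr 1; ext k; push_cast; ring
      rw [mul_comm _ u, ← h3, hFs u hu]
      simp only [hG]
      rw [← tsum_mul_left, ← tsum_mul_left, ← (t1.mul_left _).tsum_sub (s1.mul_left _)]
      congr 1; ext k
      simp only [hδ]
      linear_combination (-u^k) * hrec k
    rw [hval]
    exact hd
  · intro η hη
    set M := ∑' k, ‖e k‖ with hM
    have hM0 : 0 ≤ M := tsum_nonneg fun _ => norm_nonneg _
    refine ⟨‖K‖ * ((1/η + 2^η) + Real.pi * 2^η) + M * 2^η, by positivity, ?_⟩
    intro u hu hu1
    have hx : 0 < ‖1 - u‖ := by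
      rw [norm_pos_iff]; exact sub_ne_zero.2 (Ne.symm hu1)
    have hx2 : ‖1 - u‖ ≤ 2 := by
      refine (norm_sub_le _ _).trans ?_
      simp; linarith
    have hl : ‖Complex.log (1-u)‖ ≤ |Real.log ‖1-u‖| + Real.pi := by
      refine (Complex.norm_le_abs_re_add_abs_im _).trans ?_
      rw [Complex.log_re, Complex.log_im]
      gcongr
      exact Complex.abs_arg_le_pi _
    have hlb := abs_log_bd η hη _ hx hx2
    have h2 : 1 ≤ 2^η * ‖1-u‖^(-η) := by
      rw [Real.rpow_neg hx.le, ← div_eq_mul_inv, le_div_iff₀ (by positivity), one_mul]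
      gcongr
    have hR : ‖∑' k, e k * u^k‖ ≤ M := by
      refine tsum_of_norm_bounded hes.hasSum fun k => ?_
      rw [norm_mul]
      exact (mul_le_of_le_one_right (norm_nonneg _) (hpowle u hu k))
    have hπ := Real.pi_pos
    set X := ‖1-u‖^(-η)
    calc ‖F u‖ ≤ ‖K‖ * ‖Complex.log (1-u)‖ + M := by
          simp only [hF]
          refine (norm_add_le _ _).trans ?_
          rw [norm_mul, norm_neg]
          gcongr
      _ ≤ ‖K‖ * ((1/η + 2^η) * X + Real.pi * (2^η * X)) + M * (2^η * X) := by
          gcongr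
          · refine hl.trans ?_
            gcongr
            nlinarith
          · nlinarith
      _ = _ := by ring

end parttwo
section partthree
open Filter Topology

lemma bdry_deriv (f f' : ℂ → ℂ) (hc : ContinuousOn f (Metric.closedBall 0 1 \ {1}))
    (hd : ∀ u, ‖u‖ < 1 → u ≠ 0 → HasDerivAt f (f' u) u) (u₀ : ℂ) (hu₀ : ‖u₀‖ = 1) (h1 : u₀ ≠ 1)
    (hc' : ContinuousWithinAt f' (Metric.ball 0 1) u₀)
    (γ : ℝ → ℂ) (γ' : ℂ) (θ : ℝ) (hγ : HasDerivAt γ γ' θ) (hγ0 : γ θ = u₀)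
    (hγ1 : ∀ t, ‖γ t‖ ≤ 1) :
    HasDerivAt (fun t => f (γ t)) (γ' * f' u₀) θ := by
  set ε : ℝ := min (‖1 - u₀‖ / 2) (1/2) with hε
  have h1' : 0 < ‖1 - u₀‖ := by rw [norm_pos_iff]; exact sub_ne_zero.2 h1.symm
  have hε0 : 0 < ε := lt_min (by positivity) (by norm_num)
  set s : Set ℂ := Metric.ball u₀ ε ∩ Metric.ball 0 1 with hs
  have hcl : closure s ⊆ Metric.closedBall 0 1 \ {1} := by
    intro y hy
    have hy1 : y ∈ Metric.closedBall u₀ ε :=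
      Metric.closure_ball_subset_closedBall (closure_mono Set.inter_subset_left hy)
    have hy2 : y ∈ Metric.closedBall (0:ℂ) 1 :=
      Metric.closure_ball_subset_closedBall (closure_mono Set.inter_subset_right hy)
    refine ⟨hy2, ?_⟩
    rintro rfl
    rw [Metric.mem_closedBall, dist_eq_norm] at hy1
    have := min_le_left (‖1 - u₀‖ / 2) (1/2)
    linarith
  have hs0 : ∀ u ∈ s, u ≠ 0 := by
    rintro u ⟨hu, -⟩ rfl
    rw [Metric.mem_ball, dist_eq_norm, zero_sub, norm_neg, hu₀] at hu
    have := min_le_right (‖1 - u₀‖ / 2) (1/2)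
    linarith
  have hsd : ∀ u ∈ s, HasDerivAt f (f' u) u := fun u hu =>
    hd u (by simpa using hu.2) (hs0 u hu)
  have hsF : ∀ u ∈ s, HasFDerivAt f
      ((ContinuousLinearMap.toSpanSingleton ℂ (f' u)).restrictScalars ℝ) u := fun u hu =>
    (hsd u hu).hasFDerivAt.restrictScalars ℝ
  have hopen : IsOpen s := Metric.isOpen_ball.inter Metric.isOpen_ball
  have key : HasFDerivWithinAt f
      ((ContinuousLinearMap.toSpanSingleton ℂ (f' u₀)).restrictScalars ℝ) (closure s) u₀ := by
    apply hasFDerivWithinAt_closure_of_tendsto_fderiv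
    · intro u hu
      exact (hsF u hu).differentiableAt.differentiableWithinAt
    · exact (convex_ball _ _).inter (convex_ball _ _)
    · exact hopen
    · intro y hy
      exact (hc y (hcl hy)).mono (subset_closure.trans hcl)
    · have h2 : Tendsto (fun y => (ContinuousLinearMap.toSpanSingleton ℂ (f' y)).restrictScalars ℝ)
          (𝓝[s] u₀) (𝓝 ((ContinuousLinearMap.toSpanSingleton ℂ (f' u₀)).restrictScalars ℝ)) := by
        have h3 : Tendsto f' (𝓝[s] u₀) (𝓝 (f' u₀)) :=
          hc'.mono_left (nhdsWithin_mono _ Set.inter_subset_right)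
        have h4 : Continuous (fun z : ℂ =>
            (ContinuousLinearMap.toSpanSingleton ℂ z).restrictScalars ℝ) := by
          have h5 : Continuous (fun z : ℂ => ContinuousLinearMap.toSpanSingleton ℂ z) :=
            (ContinuousLinearMap.toSpanSingletonCLE (𝕜 := ℂ) (E := ℂ)).continuous
          exact (ContinuousLinearMap.continuous_restrictScalars ℝ).comp h5
        exact (h4.tendsto _).comp h3
      refine h2.congr' ?_
      filter_upwards [self_mem_nhdsWithin] with y hy
      exact (hsF y hy).fderiv.symm
  have hmem : closure s ∈ 𝓝[Metric.closedBall 0 1] u₀ := by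
    have : Metric.ball u₀ ε ∩ closure (Metric.ball (0:ℂ) 1) ⊆ closure s :=
      Metric.isOpen_ball.inter_closure
    rw [closure_ball (0:ℂ) one_ne_zero] at this
    refine mem_of_superset ?_ this
    exact inter_mem (mem_nhdsWithin_of_mem_nhds (Metric.ball_mem_nhds _ hε0)) self_mem_nhdsWithin
  have key2 := key.mono_of_mem_nhdsWithin hmem
  subst hγ0
  have := key2.comp_hasDerivAt θ hγ (Eventually.of_forall fun t => by simpa using hγ1 t)
  simpa [Function.comp_def] using this

/-- first-order form of the Legendre equation in the angle variable -/
def LSol (l : ℂ) (y z : ℝ → ℂ) : Prop :=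
  ∀ t ∈ Set.Ioo (0:ℝ) Real.pi, HasDerivAt y (z t / (Real.sin t : ℂ)) t ∧
    HasDerivAt z (-l * (Real.sin t : ℂ) * y t) t

lemma wronsk (l : ℂ) (y z y' z' : ℝ → ℂ) (h : LSol l y z) (h' : LSol l y' z') (w : ℂ)
    (F : Filter ℝ) [F.NeBot] (hF : Set.Ioo (0:ℝ) Real.pi ∈ F)
    (hl : Tendsto (fun t => y t * z' t - z t * y' t) F (𝓝 w)) :
    ∀ t ∈ Set.Ioo (0:ℝ) Real.pi, y t * z' t - z t * y' t = w := by
  have hder : ∀ t ∈ Set.Ioo (0:ℝ) Real.pi,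
      HasDerivAt (fun t => y t * z' t - z t * y' t) 0 t := by
    intro t ht
    obtain ⟨h1, h2⟩ := h t ht
    obtain ⟨h3, h4⟩ := h' t ht
    have := (h1.mul h4).sub (h2.mul h3)
    exact this.congr_deriv (by ring)
  have hconst : ∀ t ∈ Set.Ioo (0:ℝ) Real.pi, ∀ t' ∈ Set.Ioo (0:ℝ) Real.pi,
      y t * z' t - z t * y' t = y t' * z' t' - z t' * y' t' := by
    intro t ht t' ht'
    refine (isOpen_Ioo.is_const_of_deriv_eq_zero (f := fun t => y t * z' t - z t * y' t)
      isPreconnected_Ioo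
      (fun x hx => (hder x hx).differentiableAt.differentiableWithinAt)
      (fun x hx => (hder x hx).deriv) ht ht')
  intro t ht
  have : Tendsto (fun t => y t * z' t - z t * y' t) F (𝓝 (y t * z' t - z t * y' t)) := by
    refine tendsto_const_nhds.congr' ?_
    filter_upwards [hF] with x hx
    exact hconst t ht x hx
  exact tendsto_nhds_unique this hl

end partthree
section partfour
open Filter Topology

structure HPkg (a b K : ℂ) (F G : ℂ → ℂ) : Prop where
  g1 : G 1 = K
  gc : ContinuousOn G (Metric.closedBall 0 1)
  fc : ContinuousOn F (Metric.closedBall 0 1 \ {1})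
  df : ∀ u, ‖u‖ < 1 → HasDerivAt F (G u / (1 - u)) u
  dg : ∀ u, ‖u‖ < 1 → u ≠ 0 → HasDerivAt G ((a * b * F u - (a + b) * G u) / u) u
  bd : ∀ η : ℝ, 0 < η → ∃ C : ℝ, 0 ≤ C ∧ ∀ u, ‖u‖ ≤ 1 → u ≠ 1 → ‖F u‖ ≤ C * ‖1 - u‖ ^ (-η)

lemma HPkg.lim {a b K : ℂ} {F G : ℂ → ℂ} (h : HPkg a b K F G) :
    Tendsto (fun u => (1 - u) * F u) (𝓝[Metric.closedBall 0 1 \ {1}] 1) (𝓝 0) := by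
  obtain ⟨C, hC, hb⟩ := h.bd (1/2) (by norm_num)
  have h0 : Tendsto (fun u : ℂ => C * ‖1 - u‖ ^ (1/2:ℝ)) (𝓝[Metric.closedBall 0 1 \ {1}] 1) (𝓝 0) := by
    have : Continuous (fun u : ℂ => C * ‖1 - u‖ ^ (1/2:ℝ)) := by
      refine continuous_const.mul (Continuous.rpow_const (by fun_prop) ?_)
      intro _; right; norm_num
    have h2 := this.tendsto 1
    simp only [sub_self, norm_zero] at h2
    rw [Real.zero_rpow (by norm_num), mul_zero] at h2
    exact h2.mono_left nhdsWithin_le_nhds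
  refine squeeze_zero_norm' ?_ h0
  filter_upwards [self_mem_nhdsWithin] with u hu
  have hu1 : u ≠ 1 := by simpa using hu.2
  have hx : 0 < ‖1 - u‖ := by
    rw [norm_pos_iff]; exact sub_ne_zero.2 (Ne.symm hu1)
  rw [norm_mul]
  calc ‖1-u‖ * ‖F u‖ ≤ ‖1-u‖ * (C * ‖1 - u‖ ^ (-(1/2):ℝ)) := by
        gcongr
        exact hb u (by simpa using hu.1) hu1
    _ = C * (‖1-u‖^(1:ℝ) * ‖1 - u‖ ^ (-(1/2):ℝ)) := by rw [Real.rpow_one]; ring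
    _ = _ := by rw [← Real.rpow_add hx]; norm_num

/-- `exp (2 i t)` -/
noncomputable def uu (t : ℝ) : ℂ := Complex.exp (2 * Complex.I * t)

lemma uu_norm (t : ℝ) : ‖uu t‖ = 1 := by
  unfold uu
  rw [show 2 * Complex.I * (t:ℂ) = ((2*t : ℝ):ℂ) * Complex.I by push_cast; ring]
  exact Complex.norm_exp_ofReal_mul_I _

lemma uu_sq (t : ℝ) : uu t = Complex.exp (Complex.I * t) ^ 2 := by
  unfold uu
  rw [← Complex.exp_nat_mul]; congr 1; push_cast; ring

lemma one_sub_uu (t : ℝ) :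
    1 - uu t = -2 * Complex.I * (Real.sin t : ℂ) * Complex.exp (Complex.I * t) := by
  rw [uu_sq, Complex.ofReal_sin, Complex.sin]
  have h : Complex.exp (-(t:ℂ) * Complex.I) = (Complex.exp (Complex.I * t))⁻¹ := by
    rw [← Complex.exp_neg]; congr 1; ring
  rw [h, mul_comm (t:ℂ) Complex.I]
  have := Complex.exp_ne_zero (Complex.I * t)
  field_simp
  rw [Complex.I_sq]
  ring

lemma uu_ne_one (t : ℝ) (ht : t ∈ Set.Ioo (0:ℝ) Real.pi) : uu t ≠ 1 := by
  have h := one_sub_uu t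
  have hs : (Real.sin t : ℂ) ≠ 0 := by
    exact_mod_cast (Real.sin_pos_of_mem_Ioo ht).ne'
  intro h1
  rw [h1, sub_self] at h
  exact mul_ne_zero (mul_ne_zero (by simp) hs) (Complex.exp_ne_zero _) h.symm

lemma uu_deriv (t : ℝ) : HasDerivAt uu (2 * Complex.I * uu t) t := by
  unfold uu
  have h1 : HasDerivAt (fun t : ℝ => 2 * Complex.I * (t:ℂ)) (2 * Complex.I) t := by
    simpa using (Complex.ofRealCLM.hasDerivAt (x := t)).const_mul (2 * Complex.I)
  exact h1.cexp.congr_deriv (by ring)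

lemma uu_cont : Continuous uu := by unfold uu; fun_prop

lemma uu_tendsto (t₀ : ℝ) (h1 : uu t₀ = 1) (Fl : Filter ℝ) (hF : Fl ≤ 𝓝 t₀)
    (hI : Set.Ioo (0:ℝ) Real.pi ∈ Fl) :
    Tendsto uu Fl (𝓝[Metric.closedBall 0 1 \ {1}] 1) := by
  rw [tendsto_nhdsWithin_iff]
  refine ⟨h1 ▸ (uu_cont.tendsto t₀).mono_left hF, ?_⟩
  filter_upwards [hI] with t ht
  exact ⟨by simp [uu_norm], by simpa using uu_ne_one t ht⟩

lemma HPkg.solF {μ K : ℂ} {F G : ℂ → ℂ} (h : HPkg (1/2) (μ+1) K F G) :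
    LSol (μ * (μ+1)) (fun t => Complex.exp (Complex.I * (μ+1) * t) * F (uu t))
      (fun t => -(1/2) * Complex.exp (Complex.I * μ * t) *
        ((μ+1) * ((1 - uu t) * F (uu t)) + 2 * uu t * G (uu t))) := by
  intro t ht
  have hu1 := uu_ne_one t ht
  have hun := uu_norm t
  have hu0 : uu t ≠ 0 := by rw [← norm_pos_iff, hun]; norm_num
  have h1u : 1 - uu t ≠ 0 := sub_ne_zero.2 hu1.symm
  have hs : (Real.sin t : ℂ) ≠ 0 := by
    exact_mod_cast (Real.sin_pos_of_mem_Ioo ht).ne'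
  have hmem : uu t ∈ Metric.closedBall (0:ℂ) 1 := by simp [hun]
  have hGw : ContinuousWithinAt G (Metric.ball 0 1) (uu t) :=
    (h.gc _ hmem).mono Metric.ball_subset_closedBall
  have hFw : ContinuousWithinAt F (Metric.ball 0 1) (uu t) := by
    refine (h.fc _ ⟨hmem, by simpa using hu1⟩).mono ?_
    intro x hx
    refine ⟨Metric.ball_subset_closedBall hx, ?_⟩
    rintro rfl
    simp at hx
  have dF : HasDerivAt (fun t => F (uu t)) (2 * Complex.I * uu t * (G (uu t) / (1 - uu t))) t :=
    bdry_deriv F (fun u => G u / (1 - u)) h.fc (fun u hu _ => h.df u hu) (uu t) hun hu1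
      (hGw.div (by fun_prop) h1u) uu _ t (uu_deriv t) rfl (fun s => (uu_norm s).le)
  have dG : HasDerivAt (fun t => G (uu t)) (2 * Complex.I * uu t *
      (((1/2) * (μ+1) * F (uu t) - (1/2 + (μ + 1)) * G (uu t)) / uu t)) t :=
    bdry_deriv G (fun u => ((1/2) * (μ+1) * F u - (1/2 + (μ + 1)) * G u) / u)
      (h.gc.mono Set.sdiff_subset) h.dg (uu t) hun hu1
      (((continuousWithinAt_const.mul hFw).sub (continuousWithinAt_const.mul hGw)).div
        continuousWithinAt_id hu0) uu _ t (uu_deriv t) rfl (fun s => (uu_norm s).le)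
  have dE : ∀ α : ℂ, HasDerivAt (fun t : ℝ => Complex.exp (Complex.I * α * t))
      (Complex.I * α * Complex.exp (Complex.I * α * t)) t := by
    intro α
    have h1 : HasDerivAt (fun t : ℝ => Complex.I * α * (t:ℂ)) (Complex.I * α) t := by
      simpa using (Complex.ofRealCLM.hasDerivAt (x := t)).const_mul (Complex.I * α)
    exact h1.cexp.congr_deriv (by ring)
  have hsplit : Complex.exp (Complex.I * (μ+1) * t)
      = Complex.exp (Complex.I * μ * t) * Complex.exp (Complex.I * t) := by
    rw [← Complex.exp_add]; congr 1; ring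
  have hone := one_sub_uu t
  have hE : Complex.exp (Complex.I * t) ≠ 0 := Complex.exp_ne_zero _
  have hsin : (Real.sin t : ℂ) = Complex.I * (1 - uu t) / (2 * Complex.exp (Complex.I * t)) := by
    rw [hone]
    field_simp
    linear_combination Complex.I_sq
  have du : HasDerivAt (fun t => 1 - uu t) (-(2 * Complex.I * uu t)) t := by
    simpa using (uu_deriv t).const_sub 1
  constructor
  · refine ((dE (μ+1)).mul dF).congr_deriv ?_
    rw [hsplit, hsin]
    have hI := Complex.I_ne_zero
    field_simp
    rw [Complex.I_sq]
    ring
  · refine (((dE μ).const_mul (-(1/2))).mul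
      (((du.mul dF).const_mul (μ+1)).add (((uu_deriv t).const_mul 2).mul dG))).congr_deriv ?_
    simp only [Pi.mul_apply, Pi.add_apply]
    rw [hsplit, hsin]
    field_simp
    ring

lemma HPkg.solP {a b K : ℂ} {F G : ℂ → ℂ} (h : HPkg a b K F G) (hab : a + b = 1) :
    LSol (-(a * b)) (fun t => F (((1 - Real.cos t)/2 : ℝ):ℂ))
      (fun t => 2 * (((1 - Real.cos t)/2 : ℝ):ℂ) * G (((1 - Real.cos t)/2 : ℝ):ℂ)) := by
  intro t ht
  have hs := Real.sin_pos_of_mem_Ioo ht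
  have hsc := Real.sin_sq_add_cos_sq t
  set v : ℝ := (1 - Real.cos t)/2 with hv
  have hv0 : 0 < v := by rw [hv]; nlinarith
  have hv1 : v < 1 := by rw [hv]; nlinarith
  have hvn : ‖(v:ℂ)‖ < 1 := by
    rw [Complex.norm_real, Real.norm_eq_abs, abs_of_pos hv0]; exact hv1
  have hv0' : (v:ℂ) ≠ 0 := by exact_mod_cast hv0.ne'
  have hv1' : 1 - (v:ℂ) ≠ 0 := by
    have : (1 - v) ≠ 0 := by linarith
    exact_mod_cast this
  have hs' : (Real.sin t : ℂ) ≠ 0 := by exact_mod_cast hs.ne'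
  have hs2 : (Real.sin t : ℂ)^2 = 4 * v * (1 - v) := by
    have : Real.sin t ^2 = 4 * v * (1 - v) := by rw [hv]; linarith
    exact_mod_cast this
  have dvR : HasDerivAt (fun t => (1 - Real.cos t)/2) (Real.sin t / 2) t := by
    have := ((Real.hasDerivAt_cos t).const_sub 1).div_const 2
    simpa using this
  have dv : HasDerivAt (fun t : ℝ => (((1 - Real.cos t)/2 : ℝ):ℂ)) ((Real.sin t / 2 : ℝ):ℂ) t :=
    dvR.ofReal_comp
  have dF := HasDerivAt.comp (𝕜 := ℝ) (𝕜' := ℂ) t (h₂ := F) (h := fun t : ℝ => (((1 - Real.cos t)/2 : ℝ):ℂ)) (h.df v hvn) dv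
  have dG := HasDerivAt.comp (𝕜 := ℝ) (𝕜' := ℂ) t (h₂ := G) (h := fun t : ℝ => (((1 - Real.cos t)/2 : ℝ):ℂ)) (h.dg v hvn hv0') dv
  constructor
  · refine dF.congr_deriv ?_
    simp only [← hv, Complex.ofReal_div, Complex.ofReal_ofNat]
    field_simp
    linear_combination G v * hs2
  · refine ((dv.const_mul 2).mul dG).congr_deriv ?_
    simp only [Function.comp_def]
    rw [← hv, hab]
    push_cast
    field_simp
    ring

lemma LSol.refl {l : ℂ} {y z : ℝ → ℂ} (h : LSol l y z) :
    LSol l (fun t => y (Real.pi - t)) (fun t => - z (Real.pi - t)) := by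
  intro t ht
  have ht' : Real.pi - t ∈ Set.Ioo (0:ℝ) Real.pi := ⟨by linarith [ht.2], by linarith [ht.1]⟩
  obtain ⟨h1, h2⟩ := h _ ht'
  rw [Real.sin_pi_sub] at h1 h2
  have d : HasDerivAt (fun t => Real.pi - t) (-1) t := by
    simpa using (hasDerivAt_id t).const_sub Real.pi
  have e1 := HasDerivAt.scomp t h1 d
  have e2 := HasDerivAt.scomp t h2 d
  refine ⟨e1.congr_deriv ?_, e2.neg.congr_deriv ?_⟩
  · simp; ring
  · simp
end partfour
section partfive
open Filter Topology

lemma sin_eq_uu (t : ℝ) :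
    (Real.sin t : ℂ) = Complex.I * (1 - uu t) / (2 * Complex.exp (Complex.I * t)) := by
  rw [one_sub_uu]
  have hE : Complex.exp (Complex.I * t) ≠ 0 := Complex.exp_ne_zero _
  field_simp
  linear_combination (Real.sin t : ℂ) * Complex.I_sq

/-- the half-angle variable -/
noncomputable def vv (t : ℝ) : ℂ := (((1 - Real.cos t)/2 : ℝ):ℂ)

lemma vv_cont : Continuous vv := by unfold vv; fun_prop

lemma vv_norm (t : ℝ) : ‖vv t‖ ≤ 1 := by
  unfold vv
  rw [Complex.norm_real, Real.norm_eq_abs, abs_le]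
  constructor <;> linarith [Real.neg_one_le_cos t, Real.cos_le_one t]

lemma vv_refl (t : ℝ) : vv (Real.pi - t) = 1 - vv t := by
  unfold vv
  rw [Real.cos_pi_sub]; push_cast; ring

lemma vv_zero : vv 0 = 0 := by simp [vv]

lemma vv_kappa (t : ℝ) (h : 1 + Real.cos t ≠ 0) :
    vv t = ((Real.sin t / (2 * (1 + Real.cos t)) : ℝ) : ℂ) * (Complex.I / (2 * Complex.exp (Complex.I * t)))
      * (1 - uu t) := by
  have h1 : (1 - Real.cos t)/2 = Real.sin t / (2 * (1 + Real.cos t)) * Real.sin t := by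
    field_simp
    linarith [Real.sin_sq_add_cos_sq t]
  unfold vv
  rw [h1, Complex.ofReal_mul]
  rw [sin_eq_uu]
  ring

lemma vv_kappa' (t : ℝ) (h : 1 - Real.cos t ≠ 0) :
    vv (Real.pi - t) = ((Real.sin t / (2 * (1 - Real.cos t)) : ℝ) : ℂ) *
      (Complex.I / (2 * Complex.exp (Complex.I * t))) * (1 - uu t) := by
  have h1 : (1 + Real.cos t)/2 = Real.sin t / (2 * (1 - Real.cos t)) * Real.sin t := by
    field_simp
    linarith [Real.sin_sq_add_cos_sq t]
  unfold vv
  rw [Real.cos_pi_sub, sub_neg_eq_add, h1, Complex.ofReal_mul]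
  rw [sin_eq_uu]
  ring

lemma uu_zero : uu 0 = 1 := by simp [uu]
lemma uu_pi : uu Real.pi = 1 := by
  unfold uu
  rw [show 2 * Complex.I * (Real.pi:ℂ) = 2 * Real.pi * Complex.I by ring]
  exact Complex.exp_two_pi_mul_I

lemma memL : Set.Ioo (0:ℝ) Real.pi ∈ 𝓝[>] (0:ℝ) := Ioo_mem_nhdsGT Real.pi_pos
lemma memR : Set.Ioo (0:ℝ) Real.pi ∈ 𝓝[<] Real.pi := Ioo_mem_nhdsLT Real.pi_pos

lemma reflR : Tendsto (fun t : ℝ => Real.pi - t) (𝓝[<] Real.pi) (𝓝[>] 0) := by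
  rw [tendsto_nhdsWithin_iff]
  constructor
  · have : Continuous (fun t : ℝ => Real.pi - t) := by fun_prop
    have h := this.tendsto Real.pi
    rw [sub_self] at h
    exact h.mono_left nhdsWithin_le_nhds
  · filter_upwards [self_mem_nhdsWithin] with t ht
    simpa using ht

lemma HPkg.vF0 {a b K : ℂ} {F G : ℂ → ℂ} (h : HPkg a b K F G) :
    Tendsto (fun t => vv t * F (uu t)) (𝓝[>] 0) (𝓝 0) := by
  have h1 := h.lim.comp (uu_tendsto 0 uu_zero (𝓝[>] 0) nhdsWithin_le_nhds memL)
  have hk : ContinuousAt (fun t : ℝ => ((Real.sin t / (2 * (1 + Real.cos t)) : ℝ) : ℂ) *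
      (Complex.I / (2 * Complex.exp (Complex.I * t)))) 0 := by
    refine ContinuousAt.mul ?_ ?_
    · refine Complex.continuous_ofReal.continuousAt.comp ?_
      refine ContinuousAt.div (by fun_prop) (by fun_prop) (by simp)
    · refine ContinuousAt.div (by fun_prop) (by fun_prop) (by simp)
  have h2 := (hk.tendsto.mono_left (nhdsWithin_le_nhds (s := Set.Ioi 0))).mul h1
  rw [mul_zero] at h2
  refine h2.congr' ?_
  filter_upwards [memL] with t ht
  have hs := Real.sin_pos_of_mem_Ioo ht
  rw [vv_kappa t (by nlinarith [Real.sin_sq_add_cos_sq t])]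
  simp only [Function.comp_def]
  ring

lemma HPkg.vFpi {a b K : ℂ} {F G : ℂ → ℂ} (h : HPkg a b K F G) :
    Tendsto (fun t => vv (Real.pi - t) * F (uu t)) (𝓝[<] Real.pi) (𝓝 0) := by
  have h1 := h.lim.comp (uu_tendsto _ uu_pi (𝓝[<] Real.pi) nhdsWithin_le_nhds memR)
  have hk : ContinuousAt (fun t : ℝ => ((Real.sin t / (2 * (1 - Real.cos t)) : ℝ) : ℂ) *
      (Complex.I / (2 * Complex.exp (Complex.I * t)))) Real.pi := by
    refine ContinuousAt.mul ?_ ?_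
    · refine Complex.continuous_ofReal.continuousAt.comp ?_
      refine ContinuousAt.div (by fun_prop) (by fun_prop) (by simp)
    · refine ContinuousAt.div (by fun_prop) (by fun_prop) (by simp)
  have h2 := (hk.tendsto.mono_left (nhdsWithin_le_nhds (s := Set.Iio Real.pi))).mul h1
  rw [mul_zero] at h2
  refine h2.congr' ?_
  filter_upwards [memR] with t ht
  have hs := Real.sin_pos_of_mem_Ioo ht
  rw [vv_kappa' t (by nlinarith [Real.sin_sq_add_cos_sq t])]
  simp only [Function.comp_def]
  ring

lemma HPkg.Glim {a b K : ℂ} {F G : ℂ → ℂ} (h : HPkg a b K F G) (w : ℝ → ℂ) (hw : ∀ t, ‖w t‖ ≤ 1)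
    (Fl : Filter ℝ) (z : ℂ) (hz : ‖z‖ ≤ 1) (hl : Tendsto w Fl (𝓝 z)) :
    Tendsto (fun t => G (w t)) Fl (𝓝 (G z)) := by
  have h1 : Tendsto G (𝓝[Metric.closedBall 0 1] z) (𝓝 (G z)) := h.gc z (by simpa using hz)
  refine h1.comp (tendsto_nhdsWithin_iff.2 ⟨hl, Eventually.of_forall fun t => ?_⟩)
  simpa using hw t

/-- limit of the quasi-derivative of the exponential-type solution -/
lemma HPkg.flim {μ K : ℂ} {F G : ℂ → ℂ} (h : HPkg (1/2) (μ+1) K F G) (t₀ : ℝ) (h1 : uu t₀ = 1)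
    (Fl : Filter ℝ) (hF : Fl ≤ 𝓝 t₀) (hI : Set.Ioo (0:ℝ) Real.pi ∈ Fl) :
    Tendsto (fun t : ℝ => -(1/2) * Complex.exp (Complex.I * μ * t) *
        ((μ+1) * ((1 - uu t) * F (uu t)) + 2 * uu t * G (uu t))) Fl
      (𝓝 (-Complex.exp (Complex.I * μ * t₀) * K)) := by
  have e1 := h.lim.comp (uu_tendsto t₀ h1 Fl hF hI)
  have e2 : Tendsto uu Fl (𝓝 1) := h1 ▸ (uu_cont.tendsto t₀).mono_left hF
  have e3 := h.Glim uu (fun t => (uu_norm t).le) Fl 1 (by simp) e2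
  rw [h.g1] at e3
  have e4 : Tendsto (fun t : ℝ => -(1/2) * Complex.exp (Complex.I * μ * t)) Fl
      (𝓝 (-(1/2) * Complex.exp (Complex.I * μ * t₀))) := by
    have : Continuous (fun t : ℝ => -(1/2) * Complex.exp (Complex.I * μ * t)) := by fun_prop
    exact (this.tendsto t₀).mono_left hF
  have e5 := e4.mul ((e1.const_mul (μ+1)).add ((e2.const_mul 2).mul e3))
  refine (e5.congr fun t => ?_).trans_eq ?_
  · simp only [Function.comp_def]
  · congr 1; ring

lemma conn {a b KP μ K : ℂ} {FP GP F G : ℂ → ℂ} (hP : HPkg a b KP FP GP) (hab : a + b = 1)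
    (hP0 : FP 0 = 1) (h : HPkg (1/2) (μ+1) K F G) (hμ : -(a * b) = μ * (μ + 1)) :
    ∀ t ∈ Set.Ioo (0:ℝ) Real.pi,
      -2 * KP * (Complex.exp (Complex.I * (μ+1) * t) * F (uu t))
        = K * (Complex.exp (Complex.I * μ * Real.pi) * FP (vv t) - FP (vv (Real.pi - t))) := by
  have sP : LSol (μ * (μ+1)) (fun t => FP (vv t)) (fun t => 2 * vv t * GP (vv t)) := by
    rw [← hμ]; exact hP.solP hab
  have sQ := sP.refl
  have sF := h.solF
  have v0 : Tendsto vv (𝓝[>] 0) (𝓝 0) := by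
    have := vv_cont.tendsto 0
    rw [vv_zero] at this
    exact this.mono_left nhdsWithin_le_nhds
  have p0 : Tendsto (fun t => FP (vv t)) (𝓝[>] 0) (𝓝 1) := by
    have h1 : Tendsto FP (𝓝 0) (𝓝 (FP 0)) := (hP.df 0 (by simp)).continuousAt
    rw [hP0] at h1
    exact h1.comp v0
  have g0 : Tendsto (fun t => GP (vv t)) (𝓝[>] 0) (𝓝 (GP 0)) :=
    hP.Glim vv vv_norm _ 0 (by simp) v0
  have pp0 : Tendsto (fun t => 2 * vv t * GP (vv t)) (𝓝[>] 0) (𝓝 0) := by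
    have := (v0.const_mul 2).mul g0
    simpa using this
  have v1 : Tendsto (fun t => vv (Real.pi - t)) (𝓝[>] 0) (𝓝 1) := by
    simp_rw [vv_refl]
    simpa using v0.const_sub 1
  have g1 : Tendsto (fun t => GP (vv (Real.pi - t))) (𝓝[>] 0) (𝓝 KP) := by
    have := hP.Glim (fun t => vv (Real.pi - t)) (fun t => vv_norm _) _ 1 (by simp) v1
    rwa [hP.g1] at this
  have vq0 : Tendsto (fun t => vv t * FP (vv (Real.pi - t))) (𝓝[>] 0) (𝓝 0) := by
    have hw : Tendsto (fun t => vv (Real.pi - t)) (𝓝[>] 0)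
        (𝓝[Metric.closedBall 0 1 \ {1}] 1) := by
      refine tendsto_nhdsWithin_iff.2 ⟨v1, ?_⟩
      filter_upwards [memL] with t ht
      refine ⟨by simpa using vv_norm _, ?_⟩
      have hs := Real.sin_pos_of_mem_Ioo ht
      intro h1
      rw [Set.mem_singleton_iff, vv_refl, sub_eq_self] at h1
      unfold vv at h1
      have h2 : (1 - Real.cos t)/2 = 0 := by exact_mod_cast h1
      nlinarith [Real.sin_sq_add_cos_sq t]
    have h1 := hP.lim.comp hw
    refine h1.congr fun t => ?_
    simp only [Function.comp_def, vv_refl]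
    ring
  -- Wronskians
  have W1 := wronsk _ _ _ _ _ sP sQ (-2 * KP) (𝓝[>] 0) memL (by
    have e1 := p0.mul ((v1.const_mul 2).mul g1).neg
    have e2 := (vq0.mul g0).const_mul 2
    have e3 := e1.sub e2
    refine (e3.congr fun t => ?_).trans_eq ?_
    · ring
    · congr 1; ring)
  have W2 := wronsk _ _ _ _ _ sP sF (-K) (𝓝[>] 0) memL (by
    have e0 := h.flim 0 uu_zero (𝓝[>] 0) nhdsWithin_le_nhds memL
    have eE : Tendsto (fun t : ℝ => Complex.exp (Complex.I * (μ+1) * t)) (𝓝[>] 0)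
        (𝓝 (Complex.exp (Complex.I * (μ+1) * (0:ℝ)))) := by
      have : Continuous (fun t : ℝ => Complex.exp (Complex.I * (μ+1) * t)) := by fun_prop
      exact (this.tendsto 0).mono_left nhdsWithin_le_nhds
    have e2 := ((h.vF0.mul g0).mul eE).const_mul 2
    have e3 := (p0.mul e0).sub e2
    refine (e3.congr fun t => ?_).trans_eq ?_
    · ring
    · congr 1; simp)
  have W3 := wronsk _ _ _ _ _ sF sQ (Complex.exp (Complex.I * μ * Real.pi) * K) (𝓝[<] Real.pi) memR (by
    have e0 := h.flim _ uu_pi (𝓝[<] Real.pi) nhdsWithin_le_nhds memR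
    have eE : Tendsto (fun t : ℝ => Complex.exp (Complex.I * (μ+1) * t)) (𝓝[<] Real.pi)
        (𝓝 (Complex.exp (Complex.I * (μ+1) * Real.pi))) := by
      have : Continuous (fun t : ℝ => Complex.exp (Complex.I * (μ+1) * t)) := by fun_prop
      exact (this.tendsto _).mono_left nhdsWithin_le_nhds
    have e2 := ((h.vFpi.mul (g0.comp reflR)).mul eE).const_mul 2
    have e3 := (e2.neg).sub (e0.mul (p0.comp reflR))
    refine (e3.congr fun t => ?_).trans_eq ?_
    · simp only [Function.comp_def]; ring
    · congr 1; ring)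
  intro t ht
  have w1 := W1 t ht
  have w2 := W2 t ht
  have w3 := W3 t ht
  linear_combination (-(Complex.exp (Complex.I * (μ+1) * t) * F (uu t))) * w1
    + FP (vv (Real.pi - t)) * w2 + FP (vv t) * w3

end partfive
section partsix
open Filter Topology

lemma sin_int (τ : ℝ) (h1 : -1 < τ) (h0 : τ ≤ 0) :
    IntervalIntegrable (fun t => Real.sin t ^ τ) volume 0 Real.pi := by
  have hπ := Real.pi_pos
  have hA : IntervalIntegrable (fun t => Real.sin t ^ τ) volume 0 (Real.pi/2) := by
    have hg : IntervalIntegrable (fun t : ℝ => (2/Real.pi)^τ * t ^ τ) volume 0 (Real.pi/2) :=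
      (intervalIntegral.intervalIntegrable_rpow' h1).const_mul _
    refine hg.mono_fun ?_ ?_
    · exact (Real.continuous_sin.measurable.pow_const τ).aestronglyMeasurable
    · rw [Set.uIoc_of_le (by positivity)]
      refine (ae_restrict_iff' measurableSet_Ioc).2 (Eventually.of_forall fun t ht => ?_)
      have hs := Real.mul_le_sin ht.1.le ht.2
      have hp : 0 < 2 / Real.pi * t := mul_pos (by positivity) ht.1
      show ‖Real.sin t ^ τ‖ ≤ ‖(2/Real.pi)^τ * t ^ τ‖
      rw [Real.norm_of_nonneg (Real.rpow_nonneg (hp.le.trans hs) _), ← Real.mul_rpow (by positivity) ht.1.le,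
        Real.norm_of_nonneg (Real.rpow_nonneg hp.le _)]
      exact Real.rpow_le_rpow_of_nonpos hp hs h0
  refine hA.trans ?_
  have hB := (hA.comp_sub_left Real.pi).symm
  simp only [Real.sin_pi_sub, sub_zero] at hB
  convert hB using 1
  ring

lemma rpow_cmp (x s τ : ℝ) (hx : 0 < x) (hx2 : x ≤ 2) (h : τ ≤ s) :
    x ^ s ≤ 2 ^ (s - τ) * x ^ τ := by
  have : x ^ s = x ^ (s - τ) * x ^ τ := by rw [← Real.rpow_add hx]; ring_nf
  rw [this]
  gcongr

lemma circ {a b K a' b' K' : ℂ} {F G F' G' : ℂ → ℂ} (h : HPkg a b K F G)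
    (h' : HPkg a' b' K' F' G') (ν : ℂ) (hν : -1 < ν.re) :
    ∫ t in (0:ℝ)..Real.pi, uu t * (F (uu t) ^ 2 * F' (uu t) * (1 - uu t) ^ ν) = 0 := by
  set H : ℂ → ℂ := fun u => F u ^ 2 * F' u * (1 - u) ^ ν with hH
  set η : ℝ := (ν.re + 1) / 12 with hη
  set τ : ℝ := min ((ν.re - 1)/2) 0 with hτ
  have hη0 : 0 < η := by rw [hη]; linarith
  have hτ1 : -1 < τ := lt_min (by linarith) (by norm_num)
  have hτ0 : τ ≤ 0 := min_le_right _ _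
  have hτs : τ ≤ ν.re - 3 * η := by
    have := min_le_left ((ν.re - 1)/2) 0
    rw [hη]; linarith
  obtain ⟨C, hC, hb⟩ := h.bd η hη0
  obtain ⟨C', hC', hb'⟩ := h'.bd η hη0
  have hHb : ∃ M : ℝ, 0 ≤ M ∧ ∀ u, ‖u‖ ≤ 1 → u ≠ 1 → ‖H u‖ ≤ M * ‖1 - u‖ ^ τ := by
    refine ⟨C^2 * C' * Real.exp (Real.pi * |ν.im|) * 2 ^ (ν.re - 3*η - τ), by positivity, ?_⟩
    intro u hu hu1
    have hx : 0 < ‖1 - u‖ := by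
      rw [norm_pos_iff]; exact sub_ne_zero.2 (Ne.symm hu1)
    have hx2 : ‖1 - u‖ ≤ 2 := by
      refine (norm_sub_le _ _).trans ?_
      simp; linarith
    have hpow : ‖(1-u)^ν‖ ≤ ‖1-u‖^ν.re * Real.exp (Real.pi * |ν.im|) := by
      rw [Complex.norm_cpow_of_ne_zero (norm_pos_iff.1 hx), div_eq_mul_inv, ← Real.exp_neg]
      gcongr
      refine (neg_le_abs _).trans ?_
      rw [abs_mul]
      gcongr
      exact Complex.abs_arg_le_pi _
    have e : (‖1-u‖^(-η))^2 * ‖1-u‖^(-η) * ‖1-u‖^ν.re = ‖1-u‖^(ν.re - 3*η) := by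
      rw [← Real.rpow_natCast, ← Real.rpow_mul hx.le, ← Real.rpow_add hx, ← Real.rpow_add hx]
      congr 1; push_cast; ring
    calc ‖H u‖ = ‖F u‖^2 * ‖F' u‖ * ‖(1-u)^ν‖ := by simp only [hH, norm_mul, norm_pow]
      _ ≤ (C * ‖1-u‖^(-η))^2 * (C' * ‖1-u‖^(-η)) * (‖1-u‖^ν.re * Real.exp (Real.pi * |ν.im|)) := by
          gcongr
          · exact hb u hu hu1
          · exact hb' u hu hu1
      _ = C^2 * C' * Real.exp (Real.pi * |ν.im|) * ‖1-u‖^(ν.re - 3*η) := by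
          rw [← e]; ring
      _ ≤ C^2 * C' * Real.exp (Real.pi * |ν.im|) * (2 ^ (ν.re - 3*η - τ) * ‖1-u‖^τ) := by
          gcongr
          exact rpow_cmp _ _ _ hx hx2 hτs
      _ = _ := by ring
  obtain ⟨M, hM, hHb⟩ := hHb
  have hHc : ContinuousOn H (Metric.closedBall 0 1 \ {1}) := by
    refine ((h.fc.pow 2).mul h'.fc).mul ?_
    refine ContinuousOn.cpow_const (by fun_prop) ?_
    rintro u ⟨hu, hu1⟩
    exact one_sub_mem_slit u (by simpa using hu) (by simpa using hu1)
  have hball : Metric.ball (0:ℂ) 1 ⊆ Metric.closedBall 0 1 \ {1} := by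
    intro x hx
    refine ⟨Metric.ball_subset_closedBall hx, ?_⟩
    rintro rfl
    simp at hx
  have hzero : ∀ r : ℝ, 0 < r → r < 1 → ∫ t in (0:ℝ)..Real.pi, (r * uu t) * H (r * uu t) = 0 := by
    intro r hr0 hr1
    have hsub : Metric.closedBall (0:ℂ) r ⊆ Metric.ball 0 1 := Metric.closedBall_subset_ball hr1
    have h1 := Complex.circleIntegral_eq_zero_of_differentiable_on_off_countable (f := H) (c := 0)
      hr0.le Set.countable_empty (hHc.mono (hsub.trans hball)) (by
        rintro z ⟨hz, -⟩
        have hz1 : ‖z‖ < 1 := by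
          have : ‖z‖ < r := by simpa using hz
          linarith
        have hz2 : z ≠ 1 := by rintro rfl; simp at hz1
        refine (((h.df z hz1).differentiableAt.pow 2).mul (h'.df z hz1).differentiableAt).mul ?_
        exact DifferentiableAt.cpow (by fun_prop) (by fun_prop)
          (one_sub_mem_slit z hz1.le hz2))
    rw [circleIntegral] at h1
    simp only [deriv_circleMap, smul_eq_mul] at h1
    have h2 := intervalIntegral.integral_comp_mul_left (a := 0) (b := Real.pi)
      (fun θ => circleMap 0 r θ * Complex.I * H (circleMap 0 r θ)) (c := 2) (by norm_num)
    rw [mul_zero, h1, smul_zero] at h2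
    have h3 : ∀ t : ℝ, circleMap 0 r (2 * t) = r * uu t := by
      intro t
      simp only [circleMap, uu, zero_add]
      congr 2; push_cast; ring
    simp_rw [h3] at h2
    have h4 : (fun t : ℝ => r * uu t * Complex.I * H (r * uu t))
        = fun t : ℝ => Complex.I * (r * uu t * H (r * uu t)) := by ext t; ring
    rw [h4, intervalIntegral.integral_const_mul] at h2
    exact (mul_eq_zero.1 h2).resolve_left Complex.I_ne_zero
  have hev : ∀ᶠ r : ℝ in 𝓝[<] 1, 0 < r ∧ r < 1 := Ioo_mem_nhdsLT one_pos
  have hnorm : ∀ (r t : ℝ), 0 < r → r < 1 → ‖(r:ℂ) * uu t‖ = r := by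
    intro r t h0 h1
    rw [norm_mul, uu_norm, mul_one, Complex.norm_real, Real.norm_of_nonneg h0.le]
  have hlim : Tendsto (fun r : ℝ => ∫ t in (0:ℝ)..Real.pi, (r * uu t) * H (r * uu t)) (𝓝[<] 1)
      (𝓝 (∫ t in (0:ℝ)..Real.pi, uu t * H (uu t))) := by
    refine intervalIntegral.tendsto_integral_filter_of_dominated_convergence
      (fun t => M * Real.sin t ^ τ) ?_ ?_ ((sin_int τ hτ1 hτ0).const_mul M) ?_
    · filter_upwards [hev] with r hr
      have hcu : Continuous (fun t : ℝ => (r:ℂ) * uu t) := continuous_const.mul uu_cont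
      have : Continuous (fun t : ℝ => ((r:ℂ) * uu t) * H (r * uu t)) := by
        refine hcu.mul (hHc.comp_continuous hcu fun t => hball ?_)
        rw [mem_ball_zero_iff, hnorm r t hr.1 hr.2]; exact hr.2
      exact this.aestronglyMeasurable
    · filter_upwards [hev] with r hr
      have : ∀ᵐ t : ℝ, t ≠ Real.pi := by
        simp [ae_iff]
      filter_upwards [this] with t htπ ht
      rw [Set.uIoc_of_le Real.pi_pos.le] at ht
      have ht' : t ∈ Set.Ioo (0:ℝ) Real.pi := ⟨ht.1, lt_of_le_of_ne ht.2 htπ⟩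
      have hs := Real.sin_pos_of_mem_Ioo ht'
      have hn := hnorm r t hr.1 hr.2
      have hne : (r:ℂ) * uu t ≠ 1 := by
        intro h; rw [h, norm_one] at hn; linarith [hr.2]
      have hb1 := hHb (r * uu t) (by rw [hn]; exact hr.2.le) hne
      have hlow : Real.sin t ≤ ‖1 - (r:ℂ) * uu t‖ := by
        have e1 : ‖1 - uu t‖ = 2 * Real.sin t := by
          rw [one_sub_uu]
          have : ‖Complex.exp (Complex.I * t)‖ = 1 := by
            rw [mul_comm]; exact Complex.norm_exp_ofReal_mul_I _
          rw [norm_mul, norm_mul, norm_mul, this, Complex.norm_real, Real.norm_of_nonneg hs.le]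
          simp
        have e2 : ‖1 - uu t‖ ≤ ‖1 - (r:ℂ) * uu t‖ + ‖((r:ℂ) - 1) * uu t‖ := by
          refine le_trans (le_of_eq ?_) (norm_add_le _ _)
          congr 1; ring
        have e3 : ‖((r:ℂ) - 1) * uu t‖ = 1 - r := by
          rw [norm_mul, uu_norm, mul_one, ← Complex.ofReal_one, ← Complex.ofReal_sub,
            Complex.norm_real, Real.norm_eq_abs, abs_of_neg (by linarith [hr.2])]
          ring
        have e4 : 1 - r ≤ ‖1 - (r:ℂ) * uu t‖ := by
          have := norm_sub_norm_le (1:ℂ) ((r:ℂ) * uu t)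
          rwa [hn, norm_one] at this
        linarith
      rw [norm_mul, hn]
      calc r * ‖H (r * uu t)‖ ≤ 1 * ‖H (r * uu t)‖ := by gcongr; exact hr.2.le
        _ ≤ M * ‖1 - (r:ℂ) * uu t‖^τ := by rw [one_mul]; exact hb1
        _ ≤ M * Real.sin t ^ τ := by
            exact mul_le_mul_of_nonneg_left (Real.rpow_le_rpow_of_nonpos hs hlow hτ0) hM
    · have : ∀ᵐ t : ℝ, t ≠ Real.pi := by
        simp [ae_iff]
      filter_upwards [this] with t htπ ht
      rw [Set.uIoc_of_le Real.pi_pos.le] at ht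
      have ht' : t ∈ Set.Ioo (0:ℝ) Real.pi := ⟨ht.1, lt_of_le_of_ne ht.2 htπ⟩
      have e1 : Tendsto (fun r : ℝ => (r:ℂ) * uu t) (𝓝[<] 1) (𝓝 (uu t)) := by
        have : Continuous (fun r : ℝ => (r:ℂ) * uu t) := by fun_prop
        have h2 := this.tendsto 1
        rw [Complex.ofReal_one, one_mul] at h2
        exact h2.mono_left nhdsWithin_le_nhds
      have e2 : Tendsto H (𝓝[Metric.closedBall 0 1 \ {1}] (uu t)) (𝓝 (H (uu t))) :=
        hHc (uu t) ⟨by simp [uu_norm], by simpa using uu_ne_one t ht'⟩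
      refine e1.mul (e2.comp (tendsto_nhdsWithin_iff.2 ⟨e1, ?_⟩))
      filter_upwards [hev] with r hr
      apply hball
      rw [mem_ball_zero_iff, hnorm r t hr.1 hr.2]; exact hr.2
  have hz : Tendsto (fun r : ℝ => ∫ t in (0:ℝ)..Real.pi, (r * uu t) * H (r * uu t)) (𝓝[<] 1)
      (𝓝 0) := by
    refine tendsto_const_nhds.congr' ?_
    filter_upwards [hev] with r hr
    exact (hzero r hr.1 hr.2).symm
  exact tendsto_nhds_unique hlim hz

end partsix
section partseven
open Filter Topology

noncomputable def hcf (a b : ℂ) (k : ℕ) : ℂ :=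
  (ascPochhammer ℂ k).eval a * (ascPochhammer ℂ k).eval b * ((Nat.factorial k : ℂ))⁻¹ *
    (Complex.Gamma (a + b + k))⁻¹

lemma hcf_rec (a b : ℂ) (k : ℕ) :
    ((k:ℂ)+1)*(a+b+k)*hcf a b (k+1) = (a+k)*(b+k)*hcf a b k := by
  unfold hcf
  rw [ascPochhammer_succ_eval, ascPochhammer_succ_eval, Nat.factorial_succ]
  have h := Complex.one_div_Gamma_eq_self_mul_one_div_Gamma_add_one (a+b+k)
  have h1 : (k:ℂ) + 1 ≠ 0 := Nat.cast_add_one_ne_zero k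
  push_cast
  rw [h, mul_inv, ← add_assoc]
  field_simp

lemma asc_ne (a : ℂ) (ha : ∀ k : ℕ, a ≠ -k) (k : ℕ) : (ascPochhammer ℂ k).eval a ≠ 0 := by
  induction k with
  | zero => simp
  | succ k ih =>
    rw [ascPochhammer_succ_eval]
    refine mul_ne_zero ih fun h => ha k (eq_neg_of_add_eq_zero_left h)

lemma pkgH (a b : ℂ) (ha : ∀ k : ℕ, a ≠ -k) (hb : ∀ k : ℕ, b ≠ -k) :
    ∃ (K : ℂ) (F G : ℂ → ℂ), K ≠ 0 ∧ (∀ u, ‖u‖ < 1 → F u = ∑' k, hcf a b k * u ^ k) ∧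
      HPkg a b K F G := by
  obtain ⟨K, F, G, h1, h2, h3, h4, h5, h6, h7, h8⟩ := pkg a b (hcf a b) (hcf_rec a b)
  refine ⟨K, F, G, h1 ?_, h2, ⟨h3, h4, h5, h6, h7, h8⟩⟩
  obtain ⟨N, hN⟩ := exists_nat_gt (-(a+b).re)
  filter_upwards [eventually_ge_atTop N] with k hk
  have hk' : (N:ℝ) ≤ k := by exact_mod_cast hk
  refine mul_ne_zero (mul_ne_zero (mul_ne_zero (asc_ne a ha k) (asc_ne b hb k)) ?_) ?_
  · exact inv_ne_zero (by exact_mod_cast Nat.factorial_ne_zero k)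
  · refine inv_ne_zero (Complex.Gamma_ne_zero_of_re_pos ?_)
    rw [Complex.add_re, Complex.natCast_re]
    linarith

lemma leg_eq (ν u : ℂ) : ∑' k, hcf (-ν) (ν+1) k * u ^ k = ordinaryHypergeometric (-ν) (ν+1) 1 u := by
  rw [ordinaryHypergeometric_eq_tsum]
  simp only [smul_eq_mul]
  congr 1; ext k
  congr 1
  unfold hcf
  have e : -ν + (ν+1) + (k:ℂ) = k + 1 := by ring
  rw [e, Complex.Gamma_nat_eq_factorial, ascPochhammer_eval_one]
  ring

lemma sin_cpow (ν : ℂ) (t : ℝ) (ht : t ∈ Set.Ioo (0:ℝ) Real.pi) :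
    Complex.exp (Complex.I * ν * t) * (2:ℂ) ^ ν * ((Real.sin t : ℝ) : ℂ) ^ ν
      = Complex.exp (Complex.I * ν * Real.pi / 2) * (1 - uu t) ^ ν := by
  have hs := Real.sin_pos_of_mem_Ioo ht
  have h1 : 1 - uu t = ((2 * Real.sin t : ℝ) : ℂ) * Complex.exp (((t - Real.pi/2 : ℝ):ℂ) * Complex.I) := by
    rw [one_sub_uu]
    have : ((t - Real.pi/2 : ℝ):ℂ) * Complex.I = Complex.I * t + (-(Real.pi/2 * Complex.I)) := by
      push_cast; ring
    rw [this, Complex.exp_add, Complex.exp_neg, Complex.exp_pi_div_two_mul_I]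
    push_cast
    rw [Complex.inv_I]; ring
  have h2 : Complex.log (1 - uu t) = ((Real.log (2 * Real.sin t) : ℝ) : ℂ) + ((t - Real.pi/2 : ℝ):ℂ) * Complex.I := by
    rw [h1, Complex.log_ofReal_mul (by positivity) (Complex.exp_ne_zero _), Complex.log_exp]
    · rw [Complex.im_ofReal_mul, Complex.I_im]; linarith [ht.1, Real.pi_pos]
    · rw [Complex.im_ofReal_mul, Complex.I_im]; linarith [ht.2, Real.pi_pos]
  have hne : 1 - uu t ≠ 0 := sub_ne_zero.2 (Ne.symm (uu_ne_one t ht))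
  have hs' : ((Real.sin t : ℝ) : ℂ) ≠ 0 := by exact_mod_cast hs.ne'
  rw [Complex.cpow_def_of_ne_zero hne, h2, Complex.cpow_def_of_ne_zero hs',
    Complex.cpow_def_of_ne_zero two_ne_zero, ← Complex.exp_add, ← Complex.exp_add, ← Complex.exp_add,
    Real.log_mul two_ne_zero hs.ne', ← Complex.ofReal_log hs.le]
  have : Complex.log 2 = ((Real.log 2 : ℝ) : ℂ) := by
    rw [Complex.ofReal_log (by norm_num)]; norm_num
  rw [this]
  congr 1
  push_cast
  ring

end partseven
section parteight
open Filter Topology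

def Good (f : ℝ → ℂ) : Prop :=
  ContinuousOn f (Set.Ioo 0 Real.pi) ∧ ∀ η : ℝ, 0 < η → ∃ C : ℝ, 0 ≤ C ∧
    ∀ t ∈ Set.Ioo (0:ℝ) Real.pi, ‖f t‖ ≤ C * Real.sin t ^ (-η)

lemma Good.refl {f : ℝ → ℂ} (h : Good f) : Good (fun t => f (Real.pi - t)) := by
  have hm : ∀ t ∈ Set.Ioo (0:ℝ) Real.pi, Real.pi - t ∈ Set.Ioo (0:ℝ) Real.pi :=
    fun t ht => ⟨by linarith [ht.2], by linarith [ht.1]⟩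
  refine ⟨h.1.comp (by fun_prop) hm, fun η hη => ?_⟩
  obtain ⟨C, hC, hb⟩ := h.2 η hη
  refine ⟨C, hC, fun t ht => ?_⟩
  have := hb _ (hm t ht)
  rwa [Real.sin_pi_sub] at this

lemma vv_sub (t : ℝ) : 1 - vv t = (((1 + Real.cos t)/2 : ℝ) : ℂ) := by
  unfold vv; push_cast; ring

lemma cos_gt (t : ℝ) (ht : t ∈ Set.Ioo (0:ℝ) Real.pi) : 0 < 1 + Real.cos t := by
  have hs := Real.sin_pos_of_mem_Ioo ht
  have := Real.sin_sq_add_cos_sq t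
  have h2 := Real.neg_one_le_cos t
  rcases h2.lt_or_eq with h | h
  · linarith
  · rw [← h] at this; nlinarith

lemma vv_ne (t : ℝ) (ht : t ∈ Set.Ioo (0:ℝ) Real.pi) : vv t ≠ 1 := by
  intro h
  have h1 := vv_sub t
  rw [h, sub_self] at h1
  have h2 : (1 + Real.cos t)/2 = 0 := by exact_mod_cast h1.symm
  linarith [cos_gt t ht]

lemma HPkg.good {a b K : ℂ} {F G : ℂ → ℂ} (h : HPkg a b K F G) : Good (fun t => F (vv t)) := by
  refine ⟨h.fc.comp vv_cont.continuousOn ?_, fun η hη => ?_⟩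
  · intro t ht
    exact ⟨by simpa using vv_norm t, by simpa using vv_ne t ht⟩
  · obtain ⟨C, hC, hb⟩ := h.bd (η/2) (by positivity)
    refine ⟨C * 4 ^ (η/2), by positivity, fun t ht => ?_⟩
    have hs := Real.sin_pos_of_mem_Ioo ht
    refine (hb _ (vv_norm t) (vv_ne t ht)).trans ?_
    rw [mul_assoc]
    refine mul_le_mul_of_nonneg_left ?_ hC
    have hc := cos_gt t ht
    rw [vv_sub, Complex.norm_real, Real.norm_of_nonneg (by positivity)]
    have e : (4:ℝ) ^ (η/2) * Real.sin t ^ (-η) = (Real.sin t ^ 2 / 4) ^ (-(η/2)) := by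
      rw [Real.div_rpow (by positivity) (by norm_num), Real.rpow_neg (by norm_num : (0:ℝ) ≤ 4),
        ← Real.rpow_natCast, ← Real.rpow_mul hs.le, div_inv_eq_mul, mul_comm]
      congr 2; push_cast; ring
    rw [e]
    refine Real.rpow_le_rpow_of_nonpos (by positivity) ?_ (by linarith)
    nlinarith [Real.sin_sq_add_cos_sq t, Real.cos_le_one t]

lemma triple_int (f g h : ℝ → ℂ) (hf : Good f) (hg : Good g) (hh : Good h) (ν : ℂ) (hν : -1 < ν.re) :
    IntervalIntegrable (fun t => f t * g t * h t * ((Real.sin t : ℝ) : ℂ) ^ ν) volume 0 Real.pi := by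
  set η : ℝ := (ν.re + 1) / 12 with hη
  set τ : ℝ := min ((ν.re - 1)/2) 0 with hτ
  have hη0 : 0 < η := by rw [hη]; linarith
  have hτ1 : -1 < τ := lt_min (by linarith) (by norm_num)
  have hτ0 : τ ≤ 0 := min_le_right _ _
  have hτs : τ ≤ ν.re - 3 * η := by
    have := min_le_left ((ν.re - 1)/2) 0
    rw [hη]; linarith
  obtain ⟨C, hC, hb⟩ := hf.2 η hη0
  obtain ⟨C', hC', hb'⟩ := hg.2 η hη0
  obtain ⟨D, hD, hd⟩ := hh.2 η hη0
  have hdom := (sin_int τ hτ1 hτ0).const_mul (C * C' * D * 2 ^ (ν.re - 3*η - τ))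
  rw [intervalIntegrable_iff_integrableOn_Ioo_of_le Real.pi_pos.le] at hdom ⊢
  refine Integrable.mono' hdom ?_ ?_
  · refine ContinuousOn.aestronglyMeasurable ?_ measurableSet_Ioo
    refine ((hf.1.mul hg.1).mul hh.1).mul ?_
    refine ContinuousOn.cpow_const (by fun_prop) ?_
    intro t ht
    exact Complex.ofReal_mem_slitPlane.2 (Real.sin_pos_of_mem_Ioo ht)
  · refine (ae_restrict_iff' measurableSet_Ioo).2 (Eventually.of_forall fun t ht => ?_)
    have hs := Real.sin_pos_of_mem_Ioo ht
    have e : Real.sin t^(-η) * Real.sin t^(-η) * Real.sin t^(-η) * Real.sin t^ν.re = Real.sin t^(ν.re - 3*η) := by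
      rw [← Real.rpow_add hs, ← Real.rpow_add hs, ← Real.rpow_add hs]
      congr 1; ring
    rw [norm_mul, norm_mul, norm_mul, Complex.norm_cpow_eq_rpow_re_of_pos hs]
    calc ‖f t‖ * ‖g t‖ * ‖h t‖ * Real.sin t ^ ν.re
        ≤ (C * Real.sin t ^ (-η)) * (C' * Real.sin t ^ (-η)) * (D * Real.sin t ^ (-η)) * Real.sin t ^ ν.re := by
          gcongr
          · exact hb t ht
          · exact hb' t ht
          · exact hd t ht
      _ = C * C' * D * Real.sin t ^ (ν.re - 3*η) := by rw [← e]; ring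
      _ ≤ C * C' * D * (2 ^ (ν.re - 3*η - τ) * Real.sin t ^ τ) := by
          refine mul_le_mul_of_nonneg_left ?_ (by positivity)
          exact rpow_cmp _ _ _ hs (by linarith [Real.sin_le_one t]) hτs
      _ = _ := by ring

lemma cov (ν : ℂ) (f : ℂ → ℂ) :
    ∫ x in (-1:ℝ)..1, f x * (1 - (x:ℂ)^2) ^ ((ν-1)/2)
      = ∫ t in (0:ℝ)..Real.pi, f ((Real.cos t : ℝ) : ℂ) * ((Real.sin t : ℝ) : ℂ) ^ ν := by
  rw [intervalIntegral.integral_of_le (by norm_num), intervalIntegral.integral_of_le Real.pi_pos.le,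
    integral_Ioc_eq_integral_Ioo, integral_Ioc_eq_integral_Ioo]
  have him : Real.cos '' Set.Ioo 0 Real.pi = Set.Ioo (-1) 1 := by
    ext x
    constructor
    · rintro ⟨t, ht, rfl⟩
      have h1 := cos_gt t ht
      have h2 := cos_gt (Real.pi - t) ⟨by linarith [ht.2], by linarith [ht.1]⟩
      rw [Real.cos_pi_sub] at h2
      exact ⟨by linarith, by linarith⟩
    · rintro ⟨h1, h2⟩
      refine ⟨Real.arccos x, ⟨Real.arccos_pos.2 h2, ?_⟩, Real.cos_arccos h1.le h2.le⟩
      refine lt_of_le_of_ne (Real.arccos_le_pi x) fun h => ?_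
      rw [Real.arccos_eq_pi] at h
      linarith
  rw [← him, integral_image_eq_integral_abs_deriv_smul measurableSet_Ioo
    (fun t _ => (Real.hasDerivAt_cos t).hasDerivWithinAt)
    (Real.injOn_cos.mono Set.Ioo_subset_Icc_self)]
  refine setIntegral_congr_fun measurableSet_Ioo fun t ht => ?_
  have hs := Real.sin_pos_of_mem_Ioo ht
  have hs' : ((Real.sin t : ℝ) : ℂ) ≠ 0 := by exact_mod_cast hs.ne'
  have e1 : 1 - ((Real.cos t : ℝ):ℂ)^2 = (((Real.sin t)^2 : ℝ) : ℂ) := by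
    rw [Real.sin_sq]; push_cast; ring
  simp only [e1, abs_neg, abs_of_pos hs]
  have e2 : (((Real.sin t)^2 : ℝ) : ℂ) ^ ((ν-1)/2) = ((Real.sin t : ℝ) : ℂ) ^ (ν - 1) := by
    rw [pow_two, Complex.ofReal_mul, Complex.mul_cpow_ofReal_nonneg hs.le hs.le, ← Complex.cpow_add _ _ hs']
    congr 1; ring
  rw [e2, Complex.cpow_sub _ _ hs', Complex.cpow_one, Complex.real_smul]
  field_simp

end parteight
section partnine
open Filter Topology

lemma leg_nat_coeff (n k : ℕ) : hcf (-(n:ℂ)) ((n:ℂ)+1) k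
    = (((Polynomial.shiftedLegendre n).coeff k : ℤ) : ℂ) := by
  rw [Polynomial.coeff_shiftedLegendre]
  unfold hcf
  have e : -(n:ℂ) + ((n:ℂ)+1) + (k:ℂ) = k + 1 := by ring
  have e2 : (n:ℂ) + 1 = ((n+1 : ℕ) : ℂ) := by push_cast; ring
  have hk : (Nat.factorial k : ℂ) ≠ 0 := by exact_mod_cast Nat.factorial_ne_zero k
  rw [e, Complex.Gamma_nat_eq_factorial, ascPochhammer_eval_neg_eq_descPochhammer,
    descPochhammer_eval_eq_descFactorial, Nat.descFactorial_eq_factorial_mul_choose, e2,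
    ← ascPochhammer_eval_cast, ascPochhammer_nat_eq_ascFactorial, Nat.ascFactorial_eq_factorial_mul_choose,
    Nat.choose_symm_add]
  push_cast
  field_simp

lemma leg_nat (n : ℕ) (x : ℂ) : legendreP n x
    = Polynomial.aeval ((1 - x)/2) (Polynomial.shiftedLegendre n) := by
  unfold legendreP
  rw [← leg_eq, Polynomial.aeval_eq_sum_range, tsum_eq_sum (s := Finset.range ((Polynomial.shiftedLegendre n).natDegree + 1))]
  · refine Finset.sum_congr rfl fun k _ => ?_
    rw [leg_nat_coeff]; simp
  · intro k hk
    rw [leg_nat_coeff, Polynomial.coeff_eq_zero_of_natDegree_lt]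
    · simp
    · have := Finset.mem_range.not.1 hk
      omega

lemma leg_nat_neg (n : ℕ) (x : ℂ) : legendreP n (-x) = (-1)^n * legendreP n x := by
  rw [leg_nat, leg_nat, Polynomial.shiftedLegendre_eval_symm]
  congr 2
  ring_nf

lemma main_nat (n : ℕ) :
    (∫ x in (-1:ℝ)..1, (legendreP n (x : ℂ)) ^ 3 * ((1 - (x:ℂ) ^ 2) ^ (((n:ℂ) - 1)/2)))
      = (3 - 2 * Complex.cos (n * Real.pi)) *
        ∫ x in (-1:ℝ)..1, (legendreP n (x : ℂ)) ^ 2 * legendreP n (-(x : ℂ)) *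
          ((1 - (x:ℂ) ^ 2) ^ (((n:ℂ) - 1)/2)) := by
  have hc : Complex.cos (n * Real.pi) = (-1)^n := by
    have := Real.cos_nat_mul_pi n
    exact_mod_cast congrArg (fun x : ℝ => (x:ℂ)) this
  rw [hc]
  simp_rw [leg_nat_neg]
  rcases Nat.even_or_odd n with h | h
  · rw [h.neg_one_pow]
    norm_num
    refine intervalIntegral.integral_congr fun x _ => ?_
    ring
  · rw [h.neg_one_pow]
    have key : ∫ x in (-1:ℝ)..1, (legendreP n (x : ℂ)) ^ 3 * ((1 - (x:ℂ) ^ 2) ^ (((n:ℂ) - 1)/2)) = 0 := by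
      have h1 := intervalIntegral.integral_comp_neg (a := -1) (b := 1)
        (fun x : ℝ => (legendreP n (x : ℂ)) ^ 3 * ((1 - (x:ℂ) ^ 2) ^ (((n:ℂ) - 1)/2)))
      simp only [Complex.ofReal_neg, leg_nat_neg, h.neg_one_pow, neg_sq, neg_neg] at h1
      have h2 : (fun x : ℝ => (-1 * legendreP n (x : ℂ)) ^ 3 * ((1 - (x:ℂ) ^ 2) ^ (((n:ℂ) - 1)/2)))
        = fun x : ℝ => -((legendreP n (x : ℂ)) ^ 3 * ((1 - (x:ℂ) ^ 2) ^ (((n:ℂ) - 1)/2))) := by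
        ext x; ring
      rw [h2, intervalIntegral.integral_neg] at h1
      exact self_eq_neg.1 h1.symm
    rw [key]
    have h3 : (fun x : ℝ => legendreP n (x : ℂ) ^ 2 * (-1 * legendreP n (x : ℂ)) * ((1 - (x:ℂ) ^ 2) ^ (((n:ℂ) - 1)/2)))
        = fun x : ℝ => -((legendreP n (x : ℂ)) ^ 3 * ((1 - (x:ℂ) ^ 2) ^ (((n:ℂ) - 1)/2))) := by
      ext x; ring
    rw [h3, intervalIntegral.integral_neg, key]
    simp

lemma main_gen (ν : ℂ) (hν : -1 < ν.re) (hn : ∀ n : ℕ, ν ≠ n) :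
    (∫ x in (-1:ℝ)..1, (legendreP ν (x : ℂ)) ^ 3 * ((1 - (x:ℂ) ^ 2) ^ ((ν - 1)/2)))
      = (3 - 2 * Complex.cos (ν * Real.pi)) *
        ∫ x in (-1:ℝ)..1, (legendreP ν (x : ℂ)) ^ 2 * legendreP ν (-(x : ℂ)) *
          ((1 - (x:ℂ) ^ 2) ^ ((ν - 1)/2)) := by
  have hpos : ∀ z : ℂ, 0 < z.re → ∀ k : ℕ, z ≠ -k := by
    intro z hz k h
    rw [h] at hz
    simp at hz
    linarith [(Nat.cast_nonneg k : (0:ℝ) ≤ k)]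
  have a1 : ∀ k : ℕ, -ν ≠ -k := fun k h => hn k (neg_injective h)
  have a2 : ∀ k : ℕ, ν + 1 ≠ -k := hpos _ (by simp; linarith)
  have a3 : ∀ k : ℕ, (1/2:ℂ) ≠ -k := hpos _ (by norm_num)
  obtain ⟨KP, FP, GP, hKP, hFP, hP⟩ := pkgH (-ν) (ν+1) a1 a2
  obtain ⟨K1, F1, G1, hK1, -, h1⟩ := pkgH (1/2) (ν+1) a3 a2
  obtain ⟨K2, F2, G2, hK2, -, h2⟩ := pkgH (1/2) ((-ν-1)+1) a3 (by simpa using a1)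
  have hFP' : ∀ u, ‖u‖ < 1 → FP u = ordinaryHypergeometric (-ν) (ν+1) 1 u := fun u hu => by
    rw [hFP u hu, leg_eq]
  have hP0 : FP 0 = 1 := by rw [hFP' 0 (by simp)]; simp
  have c1 := conn hP (by ring) hP0 h1 (by ring)
  have c2 := conn hP (by ring) hP0 h2 (by ring)
  set p : ℝ → ℂ := fun t => FP (vv t) with hp
  set q : ℝ → ℂ := fun t => FP (vv (Real.pi - t)) with hq
  set S : ℝ → ℂ := fun t => ((Real.sin t : ℝ) : ℂ) ^ ν with hS
  set e : ℂ := Complex.exp (Complex.I * ν * Real.pi) with he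
  have he0 : e ≠ 0 := Complex.exp_ne_zero _
  have he2 : Complex.exp (Complex.I * (-ν-1) * Real.pi) = -e⁻¹ := by
    have : Complex.I * (-ν-1) * Real.pi = -(Complex.I * ν * Real.pi) + -(Real.pi * Complex.I) := by ring
    rw [this, Complex.exp_add, Complex.exp_neg, Complex.exp_neg, Complex.exp_pi_mul_I, ← he]
    norm_num
  have gp : Good p := hP.good
  have gq : Good q := gp.refl
  have vlt : ∀ t ∈ Set.Ioo (0:ℝ) Real.pi, ‖vv t‖ < 1 := by
    intro t ht
    have hc := cos_gt t ht
    have : 0 ≤ 1 - Real.cos t := by linarith [Real.cos_le_one t]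
    unfold vv
    rw [Complex.norm_real, Real.norm_of_nonneg (by positivity)]
    linarith
  have hmr : ∀ t ∈ Set.Ioo (0:ℝ) Real.pi, Real.pi - t ∈ Set.Ioo (0:ℝ) Real.pi :=
    fun t ht => ⟨by linarith [ht.2], by linarith [ht.1]⟩
  have pl : ∀ t ∈ Set.Ioo (0:ℝ) Real.pi, legendreP ν ((Real.cos t : ℝ) : ℂ) = p t := by
    intro t ht
    simp only [hp]
    rw [hFP' _ (vlt t ht)]
    unfold legendreP vv
    congr 1; push_cast; ring
  have ql : ∀ t ∈ Set.Ioo (0:ℝ) Real.pi, legendreP ν (-((Real.cos t : ℝ) : ℂ)) = q t := by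
    intro t ht
    have := pl _ (hmr t ht)
    rw [Real.cos_pi_sub, Complex.ofReal_neg] at this
    exact this
  have congr_int : ∀ f g : ℝ → ℂ, (∀ t ∈ Set.Ioo (0:ℝ) Real.pi, f t = g t) →
      ∫ t in (0:ℝ)..Real.pi, f t = ∫ t in (0:ℝ)..Real.pi, g t := by
    intro f g hfg
    rw [intervalIntegral.integral_of_le Real.pi_pos.le, intervalIntegral.integral_of_le Real.pi_pos.le,
      integral_Ioc_eq_integral_Ioo, integral_Ioc_eq_integral_Ioo]
    exact setIntegral_congr_fun measurableSet_Ioo hfg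
  have hqr : ∀ t, q (Real.pi - t) = p t := by intro t; simp [hp, hq]
  have hpr : ∀ t, p (Real.pi - t) = q t := by intro t; simp [hp, hq]
  have hSr : ∀ t, S (Real.pi - t) = S t := by intro t; simp only [hS, Real.sin_pi_sub]
  have rfl_int : ∀ f : ℝ → ℂ, ∫ t in (0:ℝ)..Real.pi, f (Real.pi - t) = ∫ t in (0:ℝ)..Real.pi, f t := by
    intro f
    rw [intervalIntegral.integral_comp_sub_left]; simp
  have I1 := triple_int p p p gp gp gp ν hν
  have I2 := triple_int p p q gp gp gq ν hν
  have I3 := triple_int q q p gq gq gp ν hν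
  have I4 := triple_int q q q gq gq gq ν hν
  rw [cov ν (fun x => legendreP ν x ^ 3), cov ν (fun x => legendreP ν x ^ 2 * legendreP ν (-x))]
  set A := ∫ t in (0:ℝ)..Real.pi, p t * p t * p t * S t with hA
  set B := ∫ t in (0:ℝ)..Real.pi, p t * p t * q t * S t with hB
  have eA : ∫ t in (0:ℝ)..Real.pi, legendreP ν ((Real.cos t : ℝ) : ℂ) ^ 3 * ((Real.sin t : ℝ) : ℂ) ^ ν = A :=
    congr_int _ _ (fun t ht => by simp only [pl t ht, hS]; ring)
  have eB : ∫ t in (0:ℝ)..Real.pi, legendreP ν ((Real.cos t : ℝ) : ℂ) ^ 2 *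
      legendreP ν (-((Real.cos t : ℝ) : ℂ)) * ((Real.sin t : ℝ) : ℂ) ^ ν = B :=
    congr_int _ _ (fun t ht => by simp only [pl t ht, ql t ht, hS]; ring)
  rw [eA, eB]
  have hA' : ∫ t in (0:ℝ)..Real.pi, q t * q t * q t * S t = A := by
    rw [hA, ← rfl_int]; simp only [hqr, hSr]
  have hB' : ∫ t in (0:ℝ)..Real.pi, q t * q t * p t * S t = B := by
    rw [hB, ← rfl_int]; simp only [hqr, hpr, hSr]
  have hz : ∫ t in (0:ℝ)..Real.pi, (e * p t - q t)^2 * (e⁻¹ * p t + q t) * S t = 0 := by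
    have h0 := circ h1 h2 ν hν
    set k : ℂ := (K1^2*K2)⁻¹ * (8 * KP^3) * ((2:ℂ)^ν)⁻¹ * Complex.exp (Complex.I * ν * Real.pi / 2) with hk
    rw [congr_int _ (fun t => k * (uu t * (F1 (uu t) ^ 2 * F2 (uu t) * (1 - uu t) ^ ν)))]
    · rw [intervalIntegral.integral_const_mul, h0, mul_zero]
    · intro t ht
      have d1 := c1 t ht
      have d2 := c2 t ht
      rw [he2] at d2
      have d3 := sin_cpow ν t ht
      have h2ν : (2:ℂ)^ν ≠ 0 := by simp [Complex.cpow_eq_zero_iff]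
      have dx : Complex.exp (Complex.I * (ν+1) * t)^2 * Complex.exp (Complex.I * (-ν-1+1) * t)
          = uu t * Complex.exp (Complex.I * ν * t) := by
        unfold uu
        rw [← Complex.exp_nat_mul, ← Complex.exp_add, ← Complex.exp_add]
        congr 1; push_cast; ring
      have m1 : e * p t - q t = K1⁻¹ * (-2 * KP * (Complex.exp (Complex.I * (ν+1) * t) * F1 (uu t))) := by
        rw [d1, inv_mul_cancel_left₀ hK1]
      have m2 : e⁻¹ * p t + q t = -(K2⁻¹ * (-2 * KP * (Complex.exp (Complex.I * (-ν-1+1) * t) * F2 (uu t)))) := by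
        rw [d2, inv_mul_cancel_left₀ hK2]; simp only [hp, hq]; ring
      have m3 : Complex.exp (Complex.I * ν * t) * S t
          = ((2:ℂ)^ν)⁻¹ * (Complex.exp (Complex.I * ν * Real.pi / 2) * (1 - uu t)^ν) := by
        rw [← d3]; simp only [hS]; field_simp
      calc (e * p t - q t)^2 * (e⁻¹ * p t + q t) * S t
          = (K1^2*K2)⁻¹ * (8 * KP^3) * (F1 (uu t)^2 * F2 (uu t)) *
            (Complex.exp (Complex.I * (ν+1) * t)^2 * Complex.exp (Complex.I * (-ν-1+1) * t)) * S t := by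
              rw [m1, m2]; field_simp; ring
        _ = (K1^2*K2)⁻¹ * (8 * KP^3) * (F1 (uu t)^2 * F2 (uu t)) * uu t *
            (Complex.exp (Complex.I * ν * t) * S t) := by rw [dx]; ring
        _ = _ := by rw [m3, hk]; ring
  have hx : (fun t => (e * p t - q t)^2 * (e⁻¹ * p t + q t) * S t) = fun t =>
      e * (p t * p t * p t * S t) + (e^2 - 2) * (p t * p t * q t * S t)
        + (e⁻¹ - 2 * e) * (q t * q t * p t * S t) + q t * q t * q t * S t := by
    ext t
    field_simp
    ring
  rw [hx, intervalIntegral.integral_add (((I1.const_mul _).add (I2.const_mul _)).add (I3.const_mul _)) I4,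
    intervalIntegral.integral_add ((I1.const_mul _).add (I2.const_mul _)) (I3.const_mul _),
    intervalIntegral.integral_add (I1.const_mul _) (I2.const_mul _),
    intervalIntegral.integral_const_mul, intervalIntegral.integral_const_mul,
    intervalIntegral.integral_const_mul, hA', hB', ← hA, ← hB] at hz
  have hem : e + 1 ≠ 0 := by
    intro h
    have h3 : Complex.exp (Complex.I * ν * Real.pi) = Complex.exp (Real.pi * Complex.I) := by
      rw [Complex.exp_pi_mul_I, ← he]; linear_combination h
    obtain ⟨n, hn'⟩ := Complex.exp_eq_exp_iff_exists_int.1 h3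
    have hπ : (Real.pi : ℂ) ≠ 0 := by exact_mod_cast Real.pi_ne_zero
    have h4 : ν = ((1 + 2 * n : ℤ) : ℂ) := by
      have h5 : (Complex.I * Real.pi) * ν = (Complex.I * Real.pi) * (1 + 2 * n) := by
        linear_combination hn'
      have := mul_left_cancel₀ (mul_ne_zero Complex.I_ne_zero hπ) h5
      rw [this]; push_cast; ring
    have h6 : (-1:ℤ) < 1 + 2 * n := by
      rw [h4, Complex.intCast_re] at hν
      exact_mod_cast hν
    obtain ⟨m, hm⟩ := Int.eq_ofNat_of_zero_le (show 0 ≤ 1 + 2 * n by omega)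
    apply hn m
    rw [h4, hm]; simp
  have hcos : 2 * Complex.cos (ν * Real.pi) = e + e⁻¹ := by
    rw [Complex.two_cos, he, ← Complex.exp_neg]
    congr 2 <;> ring
  rw [hcos]
  have hfin : (e + 1) * (e * A - (3 * e - e^2 - 1) * B) = 0 := by
    have : e * (e * A + (e^2-2) * B + (e⁻¹ - 2 * e) * B + A) = 0 := by rw [hz, mul_zero]
    have hee : e * e⁻¹ = 1 := mul_inv_cancel₀ he0
    linear_combination this - B * hee
  have hfin2 := (mul_eq_zero.1 hfin).resolve_left hem
  field_simp
  linear_combination hfin2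

end partnine

theorem stmt5 (ν : ℂ) (hν : -1 < ν.re) :
    (∫ x in (-1:ℝ)..1, (legendreP ν (x : ℂ)) ^ 3 * ((1 - (x:ℂ) ^ 2) ^ ((ν - 1)/2)))
      = (3 - 2 * Complex.cos (ν * π)) *
        ∫ x in (-1:ℝ)..1, (legendreP ν (x : ℂ)) ^ 2 * legendreP ν (-(x : ℂ)) *
          ((1 - (x:ℂ) ^ 2) ^ ((ν - 1)/2)) := by
  by_cases h : ∃ n : ℕ, ν = n
  · obtain ⟨n, rfl⟩ := h
    exact main_nat n
  · push Not at h
    exact main_gen ν hν h
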